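/- arXiv:2306.06588 — 2 statements merged into one kernel-verified Lean document; each statement's English description precedes it below -/
import Mathlib

section
/- Suppose p ≥ 5, q > d^2 where d := gcd(k, q−1), p does not divide k, and gcd((q−1)/d, p−1) ≥ 2. If 2n > p^2 − 3p + 9 and q^n > (k−1)^4, then every matrix in M_n(𝔽_q) can be written as A^k + B^k with A, B ∈ M_n(𝔽_q). -/
namespace W16

/-- conjugate matrices, with explicit inverse -/
def Sim {n : ℕ} {F : Type*} [Field F] (M N : Matrix (Fin n) (Fin n) F) : Prop :=
  ∃ P Q : Matrix (Fin n) (Fin n) F, P * Q = 1 ∧ Q * P = 1 ∧ N = P * M * Q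

lemma Sim.trans {n : ℕ} {F : Type*} [Field F] {A B C : Matrix (Fin n) (Fin n) F}
    (h₁ : Sim A B) (h₂ : Sim B C) : Sim A C := by
  obtain ⟨P, Q, h1, h2, rfl⟩ := h₁
  obtain ⟨P', Q', h3, h4, rfl⟩ := h₂
  refine ⟨P' * P, Q * Q', ?_, ?_, ?_⟩
  · rw [show P' * P * (Q * Q') = P' * (P * Q) * Q' by simp only [mul_assoc], h1, mul_one, h3]
  · rw [show Q * Q' * (P' * P) = Q * (Q' * P') * P by simp only [mul_assoc], h4, mul_one, h2]
  · simp only [mul_assoc]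

lemma Sim.trace {n : ℕ} {F : Type*} [Field F] {A B : Matrix (Fin n) (Fin n) F}
    (h : Sim A B) : B.trace = A.trace := by
  obtain ⟨P, Q, h1, h2, rfl⟩ := h
  rw [Matrix.trace_mul_comm, ← mul_assoc, h2, one_mul]

lemma sim_transv {n : ℕ} {F : Type*} [Field F] (M : Matrix (Fin n) (Fin n) F)
    (a b : Fin n → F) (hab : b ⬝ᵥ a = 0) :
    Sim M (Matrix.of fun j l => M j l + a j * (∑ i, b i * M i l) - (∑ i, M j i * a i) * b l
      - a j * (∑ i, b i * (∑ s, M i s * a s)) * b l) := by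
  have hsq : Matrix.vecMulVec a b * Matrix.vecMulVec a b = 0 := by
    rw [Matrix.vecMulVec_mul_vecMulVec, hab]; simp
  refine ⟨1 + Matrix.vecMulVec a b, 1 - Matrix.vecMulVec a b, ?_, ?_, ?_⟩
  · rw [add_mul, mul_sub, mul_sub, hsq]; simp
  · rw [sub_mul, mul_add, mul_add, hsq]; simp
  · have h1 : ∀ j l, (Matrix.vecMulVec a b * M) j l = a j * (∑ i, b i * M i l) := by
      intro j l
      simp [Matrix.mul_apply, Matrix.vecMulVec_apply, Finset.mul_sum, mul_assoc]
    have h2 : ∀ j l, (M * Matrix.vecMulVec a b) j l = (∑ i, M j i * a i) * b l := by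
      intro j l
      simp [Matrix.mul_apply, Matrix.vecMulVec_apply, Finset.sum_mul, mul_assoc]
    have h3 : ∀ j l, (Matrix.vecMulVec a b * (M * Matrix.vecMulVec a b)) j l
        = a j * (∑ i, b i * (∑ s, M i s * a s)) * b l := by
      intro j l
      rw [Matrix.mul_apply]
      simp_rw [h2, Matrix.vecMulVec_apply]
      rw [Finset.mul_sum, Finset.sum_mul]
      exact Finset.sum_congr rfl fun i _ => by ring
    ext j l
    rw [mul_sub, add_mul, mul_one, one_mul, add_mul, Matrix.mul_assoc]
    simp only [Matrix.add_apply, Matrix.sub_apply, Matrix.of_apply]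
    rw [h1, h2, h3]; ring

/-- a nonscalar matrix is similar to one with a nonzero off-diagonal entry -/
lemma sim_offdiag {n : ℕ} {F : Type*} [Field F] (M : Matrix (Fin n) (Fin n) F)
    (hM : ∀ c : F, M ≠ c • 1) : ∃ N, Sim M N ∧ ∃ j i, i ≠ j ∧ N j i ≠ 0 := by
  by_cases h : ∃ j i, i ≠ j ∧ M j i ≠ 0
  · exact ⟨M, ⟨1, 1, by simp, by simp, by simp⟩, h⟩
  push Not at h
  have : ∃ i j, M i i ≠ M j j := by
    by_contra! h'
    rcases n with _ | n
    · exact hM 0 (by ext i; exact i.elim0)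
    · apply hM (M 0 0)
      ext i j
      by_cases hij : i = j
      · subst hij; simp [h' i 0]
      · simp [hij, h i j (Ne.symm hij)]
  obtain ⟨i, j, hij⟩ := this
  have hne : i ≠ j := by rintro rfl; exact hij rfl
  refine ⟨_, sim_transv M (Pi.single i 1) (Pi.single j 1) (by simp [hne]), i, j, hne.symm, ?_⟩
  simp [Pi.single_apply, h i j hne.symm, h j i hne]
  intro h0; exact hij (by linear_combination -h0)

lemma sim_row {n : ℕ} {F : Type*} [Field F] (M : Matrix (Fin n) (Fin n) F)
    {i j : Fin n} (hij : i ≠ j) (hM : M j i ≠ 0) :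
    ∃ N, Sim M N ∧ ∀ l, l ≠ j → N j l ≠ 0 := by
  let v : Fin n → F := fun l => if l = i ∨ l = j then 0 else (M j l - 1) / M j i
  refine ⟨_, sim_transv M (Pi.single i 1) v (by simp [v]), ?_⟩
  intro l hl
  simp only [Matrix.of_apply, Pi.single_apply, hij.symm, if_false, zero_mul, add_zero, mul_ite, mul_one, mul_zero,
    Finset.sum_ite_eq', Finset.mem_univ, if_true, sub_zero]
  by_cases hli : l = i
  · subst hli; simpa [v] using hM
  · simp only [v, hli, hl, or_self, if_false]
    field_simp
    simp

lemma sim_diag {n : ℕ} {F : Type*} [Field F] (M : Matrix (Fin n) (Fin n) F)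
    (hM : ∀ c : F, M ≠ c • 1) (t : Fin n → F) (ht : ∑ i, t i = M.trace) :
    ∃ N, Sim M N ∧ ∀ i, N i i = t i := by
  obtain ⟨N₁, h1, j, i, hij, hN1⟩ := sim_offdiag M hM
  obtain ⟨N₂, h2, hrow⟩ := sim_row N₁ hij hN1
  let x : Fin n → F := fun l => if l = j then 0 else (t l - N₂ l l) / N₂ j l
  have hs := sim_transv N₂ x (Pi.single j 1) (by simp [x])
  refine ⟨_, (h1.trans h2).trans hs, ?_⟩
  set N := (Matrix.of fun (s l : Fin n) => N₂ s l + x s * (∑ i, (Pi.single j 1 : Fin n → F) i * N₂ i l)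
      - (∑ i, N₂ s i * x i) * (Pi.single j 1 : Fin n → F) l
      - x s * (∑ i, (Pi.single j 1 : Fin n → F) i * (∑ s, N₂ i s * x s)) *
        (Pi.single j 1 : Fin n → F) l) with hN
  have key : ∀ l, l ≠ j → N l l = t l := by
    intro l hl
    have := hrow l hl
    simp only [hN, Matrix.of_apply, Pi.single_apply, hl, if_false, mul_zero, sub_zero, ite_mul, one_mul, zero_mul,
      Finset.sum_ite_eq', Finset.mem_univ, if_true]
    simp only [x, hl, if_false]
    field_simp
    ring
  intro l
  by_cases hl : l = j
  · subst hl
    have htr := ((h1.trans h2).trans hs).trace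
    rw [← ht] at htr
    unfold Matrix.trace at htr
    rw [← Finset.add_sum_erase _ _ (Finset.mem_univ l),
      ← Finset.add_sum_erase _ t (Finset.mem_univ l)] at htr
    have : ∑ x ∈ Finset.univ.erase l, Matrix.diag N x = ∑ x ∈ Finset.univ.erase l, t x :=
      Finset.sum_congr rfl fun s hs => key s (Finset.ne_of_mem_erase hs)
    rw [this] at htr
    exact add_right_cancel htr
  · exact key l hl

end W16

namespace W16
open Polynomial

lemma group_root {G : Type*} [Group G] (a g : G) (hc : Commute a g) (m k : ℕ)
    (hmk : Nat.Coprime m k) (h : g ^ k = a ^ m) : ∃ b : G, b ^ k = a := by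
  have hb := Nat.gcd_eq_gcd_ab m k
  rw [hmk.gcd_eq_one] at hb
  set u := Nat.gcdA m k
  set v := Nat.gcdB m k
  refine ⟨g ^ u * a ^ v, ?_⟩
  have hc' : Commute (g ^ u) (a ^ v) := (hc.symm.zpow_left u).zpow_right v
  rw [hc'.mul_pow, ← zpow_natCast, ← zpow_mul, mul_comm u, zpow_mul, zpow_natCast, h,
    ← zpow_natCast, ← zpow_natCast, ← zpow_mul, ← zpow_mul, ← zpow_add, mul_comm v, ← hb]
  simp

lemma matrix_root {n : ℕ} {F : Type*} [Field F] (p : ℕ) (hp : p.Prime) [CharP F p]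
    (k : ℕ) (hk : 1 ≤ k) (hpk : ¬ p ∣ k) (A : Matrix (Fin n) (Fin n) F)
    (x : Fin n → F) (hx : ∀ i, x i ≠ 0 ∧ ∃ y, y ^ k = x i)
    (hA : A.charpoly = ∏ i, (X - C (x i))) : ∃ B, B ^ k = A := by
  classical
  have : Fact p.Prime := ⟨hp⟩
  choose hx0 y hy using hx
  let S : Finset F := Finset.univ.image x
  let f : F → F := fun s => if h : ∃ i, x i = s then y h.choose else 0
  have hf : ∀ s ∈ S, f s ^ k = s := by
    intro s hs
    have h : ∃ i, x i = s := by simpa [S] using hs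
    simp only [f, h, dif_pos]
    rw [hy, h.choose_spec]
  let P : F[X] := ∏ s ∈ S, (X - C s)
  let g : F[X] := Lagrange.interpolate S id f
  have hg : ∀ s ∈ S, g.eval s = f s := fun s hs =>
    Lagrange.eval_interpolate_at_node (v := id) f (Set.injOn_id _) hs
  have hPg : P ∣ g ^ k - X := by
    apply Finset.prod_dvd_of_coprime
    · intro a _ b _ hab
      exact isCoprime_X_sub_C_of_isUnit_sub (sub_ne_zero.2 hab).isUnit
    · intro s hs
      rw [dvd_iff_isRoot, IsRoot, eval_sub, eval_pow, eval_X, hg s hs, hf s hs, sub_self]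
  have hdv : A.charpoly ∣ P ^ p ^ n := by
    have h1 : A.charpoly ∣ P ^ n := by
      rw [hA]
      calc ∏ i, (X - C (x i)) ∣ ∏ i : Fin n, P :=
            Finset.prod_dvd_prod_of_dvd _ _ fun i _ =>
              Finset.dvd_prod_of_mem (fun s => X - C s) (by simp [S])
        _ = P ^ n := by simp
    exact h1.trans (pow_dvd_pow _ (Nat.lt_pow_self hp.one_lt).le)
  have hdv2 : A.charpoly ∣ (g ^ p ^ n) ^ k - X ^ p ^ n := by
    have h2 := hdv.trans (pow_dvd_pow_of_dvd hPg (p ^ n))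
    rw [sub_pow_char_pow] at h2
    rwa [← pow_mul, mul_comm, pow_mul]
  have hroot : (aeval A g ^ p ^ n) ^ k = A ^ p ^ n := by
    obtain ⟨c, hc⟩ := hdv2
    have h3 := congrArg (aeval A) hc
    rw [map_mul, Matrix.aeval_self_charpoly, zero_mul] at h3
    simpa [sub_eq_zero] using h3
  have hAu : IsUnit A := by
    rw [Matrix.isUnit_iff_isUnit_det, isUnit_iff_ne_zero, Matrix.det_eq_sign_charpoly_coeff, hA,
      coeff_zero_eq_eval_zero, eval_prod]
    refine mul_ne_zero (by simp) (Finset.prod_ne_zero_iff.2 fun i _ => by simpa using hx0 i)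
  have hGu : IsUnit (aeval A g ^ p ^ n) := by
    rw [← isUnit_pow_iff (by omega : k ≠ 0), hroot]
    exact hAu.pow _
  obtain ⟨a, ha⟩ := hAu
  obtain ⟨G, hG⟩ := hGu
  have hcomm : Commute a G := by
    have h4 : Commute A (aeval A g ^ p ^ n) := by
      apply Commute.pow_right
      have := (Commute.all (X : F[X]) g).map (aeval A)
      simpa using this
    apply Units.ext
    push_cast
    rw [ha, hG]
    exact h4
  obtain ⟨b, hb⟩ := group_root a G hcomm (p ^ n) k
    (Nat.Coprime.pow_left _ ((Nat.Prime.coprime_iff_not_dvd hp).2 hpk))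
    (by ext1; push_cast; rw [ha, hG, hroot])
  exact ⟨b, by rw [← ha, ← hb]; simp⟩


lemma tri_root {n : ℕ} {F : Type*} [Field F] (p : ℕ) (hp : p.Prime) [CharP F p]
    (k : ℕ) (hk : 1 ≤ k) (hpk : ¬ p ∣ k) (A : Matrix (Fin n) (Fin n) F)
    (hA : ∀ i j, j < i → A i j = 0) (hx : ∀ i, A i i ≠ 0 ∧ ∃ y, y ^ k = A i i) :
    ∃ B, B ^ k = A :=
  matrix_root p hp k hk hpk A _ hx (Matrix.charpoly_of_isUpperTriangular A fun i j h => hA i j h)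

lemma sim_pow {n : ℕ} {F : Type*} [Field F] (P Q A : Matrix (Fin n) (Fin n) F) (h : P * Q = 1)
    (k : ℕ) : (Q * A * P) ^ k = Q * A ^ k * P := by
  have hQ : Q * P = 1 := mul_eq_one_comm.1 h
  induction k with
  | zero => simp [hQ]
  | succ k ih =>
    rw [pow_succ, ih, pow_succ]
    calc Q * A ^ k * P * (Q * A * P) = Q * A ^ k * (P * Q) * A * P := by simp only [mul_assoc]
      _ = _ := by rw [h]; simp only [mul_assoc, one_mul]

lemma nonscalar {n : ℕ} {F : Type*} [Field F] (p : ℕ) (hp : p.Prime) [CharP F p]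
    (k : ℕ) (hk : 1 ≤ k) (hpk : ¬ p ∣ k) (M : Matrix (Fin n) (Fin n) F)
    (hM : ∀ c : F, M ≠ c • 1) (x y : Fin n → F) (hx : ∀ i, x i ≠ 0 ∧ ∃ z, z ^ k = x i)
    (hy : ∀ i, y i ≠ 0 ∧ ∃ z, z ^ k = y i) (hxy : ∑ i, x i + ∑ i, y i = M.trace) :
    ∃ A B : Matrix (Fin n) (Fin n) F, M = A ^ k + B ^ k := by
  obtain ⟨N, ⟨P, Q, hPQ, hQP, hN⟩, hd⟩ := sim_diag M hM (fun i => x i + y i)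
    (by rw [Finset.sum_add_distrib, hxy])
  obtain ⟨A, hA⟩ := tri_root p hp k hk hpk
    (Matrix.of fun i j => if i < j then N i j else if i = j then x i else 0)
    (fun i j h => by simp [not_lt.2 h.le, h.ne']) (fun i => by simpa using hx i)
  obtain ⟨B, hB⟩ := tri_root p hp k hk hpk
    (Matrix.of fun i j => if i < j then N j i else if i = j then y i else 0)
    (fun i j h => by simp [not_lt.2 h.le, h.ne']) (fun i => by simpa using hy i)
  have hNAB : N = A ^ k + (Matrix.transpose B) ^ k := by
    rw [← Matrix.transpose_pow, hA, hB]
    ext i j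
    rcases lt_trichotomy i j with h | h | h
    · simp [h, not_lt.2 h.le, h.ne']
    · subst h; simp [hd]
    · simp [h, not_lt.2 h.le, h.ne']
  refine ⟨Q * A * P, Q * (Matrix.transpose B) * P, ?_⟩
  rw [sim_pow P Q _ hPQ, sim_pow P Q _ hPQ, ← add_mul, ← mul_add, ← hNAB, hN]
  calc M = (Q * P) * M * (Q * P) := by rw [hQP]; simp
    _ = _ := by simp only [mul_assoc]

end W16

namespace W16
open Finset
open scoped Pointwise

lemma exists_xi {F : Type*} [Field F] [Fintype F] [DecidableEq F] (A : Finset F)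
    (hA : Fintype.card F < #A ^ 2) :
    ∃ ξ : F, Fintype.card F < 2 * #(A + A.image (ξ * ·)) := by
  set q := Fintype.card F with hq
  set m := #A with hm
  have hmq : m ≤ q := card_le_univ A
  have hq2 : 2 ≤ q := Fintype.one_lt_card
  let E : F → ℕ := fun ξ => #{x ∈ (A ×ˢ A) ×ˢ (A ×ˢ A) | x.1.1 + ξ * x.2.1 = x.1.2 + ξ * x.2.2}
  have hE : ∀ ξ : F, ξ ≠ 0 → m ^ 4 ≤ #(A + A.image (ξ * ·)) * E ξ := by
    intro ξ hξ
    have h1 := le_card_add_mul_addEnergy A (A.image (ξ * ·))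
    have h2 : #(A.image (ξ * ·)) = m := card_image_of_injective _ (mul_right_injective₀ hξ)
    rw [h2, ← hm, ← pow_add] at h1
    refine h1.trans (Nat.mul_le_mul_left _ ?_)
    refine card_le_card_of_injOn (fun x => (x.1, (ξ⁻¹ * x.2.1, ξ⁻¹ * x.2.2))) ?_ ?_
    · rintro ⟨⟨a, b⟩, c, d⟩ h
      simp only [coe_filter, mem_product, mem_image, Set.mem_ofPred_eq] at h ⊢
      obtain ⟨⟨h1, ⟨c, hc, rfl⟩, d, hd, rfl⟩, h2⟩ := h
      simp [hξ, h1, hc, hd, h2]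
    · rintro ⟨⟨a, b⟩, c, d⟩ _ ⟨⟨a', b'⟩, c', d'⟩ _ h
      simpa [hξ] using h
  have hsum : ∑ ξ ∈ univ.erase (0 : F), E ξ ≤ (q - 1) * (m * m) + (m * m - m) * (m * m - m) := by
    have h1 : ∑ ξ ∈ univ.erase (0 : F), E ξ = ∑ x ∈ (A ×ˢ A) ×ˢ (A ×ˢ A),
        #{ξ ∈ univ.erase (0 : F) | x.1.1 + ξ * x.2.1 = x.1.2 + ξ * x.2.2} := by
      simp only [E, card_filter]
      rw [sum_comm]
    rw [h1]
    calc _ ≤ ∑ x ∈ (A ×ˢ A) ×ˢ (A ×ˢ A),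
          ((q - 1) * ((if x.1.1 = x.1.2 then 1 else 0) * (if x.2.1 = x.2.2 then 1 else 0)) +
            (if x.1.1 ≠ x.1.2 then 1 else 0) * (if x.2.1 ≠ x.2.2 then 1 else 0)) := by
          apply sum_le_sum
          rintro ⟨⟨a, b⟩, c, d⟩ _
          by_cases hab : a = b <;> by_cases hcd : c = d
          · simp only [hab, hcd]
            refine (card_filter_le _ _).trans ?_
            simp [card_erase_of_mem, hq]
          · subst hab
            rw [filter_eq_empty_iff.2]
            · simp
            · intro ξ hξ
              have : ξ ≠ 0 := ne_of_mem_erase hξ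
              simp [this, hcd]
          · subst hcd
            simp [hab]
          · simp only [hab, hcd, if_false, ne_eq, not_false_eq_true, if_true]
            simp only [mul_zero, zero_add, mul_one]
            refine card_le_one.2 fun ξ hξ η hη => ?_
            simp only [mem_filter] at hξ hη
            have h3 : (ξ - η) * (c - d) = 0 := by linear_combination hξ.2 - hη.2
            rcases mul_eq_zero.1 h3 with h | h
            · exact sub_eq_zero.1 h
            · exact absurd (sub_eq_zero.1 h) hcd
      _ = _ := by
          rw [sum_add_distrib, ← mul_sum]
          have hD : ∑ y ∈ A ×ˢ A, (if y.1 = y.2 then 1 else 0) = m := by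
            rw [← card_filter, ← diag_eq_filter, diag_card]
          have hO : ∑ y ∈ A ×ˢ A, (if y.1 ≠ y.2 then 1 else 0) = m * m - m := by
            rw [← card_filter, hm, ← offDiag_card]
            congr 1
            ext ⟨a, b⟩
            simp [and_assoc]
          have hP : ∀ f g : F × F → ℕ, ∑ x ∈ (A ×ˢ A) ×ˢ (A ×ˢ A), f x.1 * g x.2 =
              (∑ y ∈ A ×ˢ A, f y) * (∑ y ∈ A ×ˢ A, g y) := by
            intro f g
            rw [sum_mul_sum, sum_product]
          rw [hP (fun y => if y.1 = y.2 then 1 else 0) (fun y => if y.1 = y.2 then 1 else 0),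
            hP (fun y => if y.1 ≠ y.2 then 1 else 0) (fun y => if y.1 ≠ y.2 then 1 else 0), hD, hO]
  have hex : ∃ ξ ∈ univ.erase (0 : F), (q - 1) * E ξ ≤
      (q - 1) * (m * m) + (m * m - m) * (m * m - m) := by
    by_contra! hcon
    have hne : (univ.erase (0 : F)).Nonempty := ⟨1, by simp⟩
    have h2 := sum_lt_sum_of_nonempty hne hcon
    rw [sum_const, ← mul_sum, card_erase_of_mem (mem_univ _), card_univ, ← hq, smul_eq_mul] at h2
    exact absurd (Nat.mul_le_mul_left (q - 1) hsum) (not_le.2 h2)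
  obtain ⟨ξ, hξ, h⟩ := hex
  refine ⟨ξ, ?_⟩
  have h2 := hE ξ (ne_of_mem_erase hξ)
  set S := #(A + A.image (ξ * ·))
  by_contra! hS
  have hm1 : 1 ≤ m := by by_contra! h0; rw [Nat.lt_one_iff.1 h0] at hA; omega
  obtain ⟨r, hr⟩ : ∃ r, q = r + 1 := ⟨q - 1, by omega⟩
  obtain ⟨s, hs⟩ : ∃ s, m = s + 1 := ⟨m - 1, by omega⟩
  have e1 : q - 1 = r := by omega
  have e2 : m * m - m = m * s := by rw [hs]; simp [mul_add]
  rw [e1, e2] at h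
  have h3 : m ^ 2 * (2 * m ^ 2 * r) ≤ m ^ 2 * (q * (r + s ^ 2)) := by
    calc m ^ 2 * (2 * m ^ 2 * r) = 2 * r * m ^ 4 := by ring
      _ ≤ 2 * r * (S * E ξ) := by gcongr
      _ = 2 * S * (r * E ξ) := by ring
      _ ≤ q * (r * (m * m) + m * s * (m * s)) := by gcongr
      _ = _ := by ring
  have h4 := Nat.le_of_mul_le_mul_left h3 (pow_pos (by omega) 2)
  have h5 : q * r < m ^ 2 * r := by
    apply Nat.mul_lt_mul_of_pos_right hA; omega
  have h6 : q * s ^ 2 ≤ m ^ 2 * r := by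
    have : s ≤ r := by omega
    rw [hr, hs]
    nlinarith [Nat.mul_le_mul_left s this, Nat.zero_le s, Nat.zero_le r]
  nlinarith

lemma glib {F : Type*} [Field F] [Fintype F] (A : Finset F)
    (hA : Fintype.card F < #A ^ 2) (hmul : ∀ a ∈ A, ∀ b ∈ A, a * b ∈ A) (t : F) :
    ∃ u₁ ∈ A, ∃ u₂ ∈ A, ∃ u₃ ∈ A, ∃ u₄ ∈ A, ∃ v₁ ∈ A, ∃ v₂ ∈ A, ∃ v₃ ∈ A, ∃ v₄ ∈ A,
      t = u₁ + u₂ + u₃ + u₄ + (-v₁) + (-v₂) + (-v₃) + (-v₄) := by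
  classical
  obtain ⟨ξ, hξ⟩ := exists_xi A hA
  set S := A + A.image (ξ * ·) with hS
  have hcov : ∀ w : F, ∃ x ∈ S, ∃ y ∈ S, x + y = w := by
    intro w
    have h1 : #(S.image (w - ·)) = #S := card_image_of_injective _ sub_right_injective
    have h2 : ¬ Disjoint S (S.image (w - ·)) := by
      intro hd
      have := card_le_univ (S ∪ S.image (w - ·))
      rw [card_union_of_disjoint hd, h1] at this
      omega
    rw [not_disjoint_iff] at h2
    obtain ⟨x, hx, hx'⟩ := h2
    obtain ⟨y, hy, rfl⟩ := mem_image.1 hx'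
    exact ⟨_, hx, y, hy, by ring⟩
  have hinj : ∃ x ∈ A ×ˢ A, ∃ y ∈ A ×ˢ A, x ≠ y ∧ x.1 + ξ * x.2 = y.1 + ξ * y.2 := by
    apply exists_ne_map_eq_of_card_lt_of_maps_to (t := univ)
    · rw [card_product, card_univ, ← sq]; exact hA
    · intro _ _; simp
  obtain ⟨⟨a₁, b₁⟩, h1, ⟨a₂, b₂⟩, h2, hne, heq⟩ := hinj
  simp only [mem_product] at h1 h2 heq
  have hb : b₁ - b₂ ≠ 0 := by
    intro h0
    have : b₁ = b₂ := sub_eq_zero.1 h0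
    subst this
    exact hne (by simpa using heq)
  obtain ⟨x, hx, y, hy, hxy⟩ := hcov (t / (b₁ - b₂))
  obtain ⟨a, ha, _, hb2, rfl⟩ := mem_add.1 hx
  obtain ⟨b, hb', rfl⟩ := mem_image.1 hb2
  obtain ⟨a', ha', _, hb3, rfl⟩ := mem_add.1 hy
  obtain ⟨b', hb'', rfl⟩ := mem_image.1 hb3
  rw [eq_div_iff hb] at hxy
  refine ⟨_, hmul _ h1.2 _ ha, _, hmul _ h1.2 _ ha', _, hmul _ h2.1 _ hb', _, hmul _ h2.1 _ hb'',
    _, hmul _ h2.2 _ ha, _, hmul _ h2.2 _ ha', _, hmul _ h1.1 _ hb', _, hmul _ h1.1 _ hb'', ?_⟩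
  rw [← hxy]
  linear_combination (b + b') * heq

end W16

namespace W16
open Finset

/-- nonzero `k`-th power -/
def NP {F : Type*} [Field F] (k : ℕ) (x : F) : Prop := x ≠ 0 ∧ ∃ y, y ^ k = x

/-- `t` is a sum of exactly `m` nonzero `k`-th powers -/
def RS {F : Type*} [Field F] (k m : ℕ) (t : F) : Prop :=
  ∃ s : Multiset F, s.card = m ∧ (∀ x ∈ s, NP k x) ∧ s.sum = t

lemma NP.mul {F : Type*} [Field F] {k : ℕ} {x y : F} (hx : NP k x) (hy : NP k y) :
    NP k (x * y) := by
  obtain ⟨hx, a, rfl⟩ := hx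
  obtain ⟨hy, b, rfl⟩ := hy
  exact ⟨mul_ne_zero hx hy, a * b, mul_pow _ _ _⟩

lemma NP.one {F : Type*} [Field F] {k : ℕ} : NP k (1 : F) := ⟨one_ne_zero, 1, one_pow _⟩

lemma NP.pow {F : Type*} [Field F] {k : ℕ} {x : F} (hx : NP k x) (i : ℕ) : NP k (x ^ i) := by
  induction i with
  | zero => simpa using NP.one
  | succ i ih => rw [pow_succ]; exact ih.mul hx

lemma RS.add {F : Type*} [Field F] {k m m' : ℕ} {t t' : F} (h : RS k m t) (h' : RS k m' t') :
    RS k (m + m') (t + t') := by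
  obtain ⟨s, h1, h2, h3⟩ := h
  obtain ⟨s', h1', h2', h3'⟩ := h'
  refine ⟨s + s', by simp [h1, h1'], ?_, by simp [h3, h3']⟩
  intro x hx
  rcases Multiset.mem_add.1 hx with h | h
  · exact h2 x h
  · exact h2' x h

lemma RS.zero {F : Type*} [Field F] {k : ℕ} : RS k 0 (0 : F) := ⟨0, by simp⟩

lemma RS.one {F : Type*} [Field F] {k : ℕ} {x : F} (hx : NP k x) : RS k 1 x :=
  ⟨{x}, by simpa using hx⟩

lemma RS.nsmul {F : Type*} [Field F] {k m : ℕ} (h : RS k m (0 : F)) (b : ℕ) :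
    RS k (b * m) (0 : F) := by
  induction b with
  | zero => simpa using RS.zero
  | succ b ih => rw [Nat.succ_mul]; simpa using ih.add h

lemma RS.char {F : Type*} [Field F] {k : ℕ} (p : ℕ) [CharP F p] : RS k p (0 : F) :=
  ⟨Multiset.replicate p 1, by simp, fun x hx => by rw [Multiset.eq_of_mem_replicate hx]; exact NP.one,
    by simp⟩

lemma RS.geom {F : Type*} [Field F] {k : ℕ} {a x : F} (ha : NP k a) (hx : NP k x) (s : Finset ℕ) :
    RS k #s (x * ∑ i ∈ s, a ^ i) :=
  ⟨s.1.map (fun i => x * a ^ i), by simp, fun y hy => by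
    obtain ⟨i, _, rfl⟩ := Multiset.mem_map.1 hy
    exact hx.mul (ha.pow i), by rw [mul_sum]; rfl⟩

/-- at most `c` summands -/
def RL {F : Type*} [Field F] (k c : ℕ) (t : F) : Prop := ∃ m ≤ c, RS k m t

lemma RL.add {F : Type*} [Field F] {k m m' : ℕ} {t t' : F} (h : RL k m t) (h' : RL k m' t') :
    RL k (m + m') (t + t') := by
  obtain ⟨s, h1, h2⟩ := h
  obtain ⟨s', h1', h2'⟩ := h'
  exact ⟨s + s', by omega, h2.add h2'⟩

lemma card_powers {F : Type*} [Field F] [Fintype F] [DecidableEq F] (k : ℕ) (hk : 1 ≤ k) :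
    #(univ.image fun x : F => x ^ k) =
      (Fintype.card F - 1) / Nat.gcd k (Fintype.card F - 1) + 1 := by
  classical
  have h1 : Nat.card (powMonoidHom k : Fˣ →* Fˣ).range =
      (Fintype.card F - 1) / Nat.gcd k (Fintype.card F - 1) := by
    rw [IsCyclic.card_powMonoidHom_range, Nat.card_eq_fintype_card, Fintype.card_units,
      Nat.gcd_comm]
  rw [← h1]
  have h2 : (univ.image fun x : F => x ^ k) =
      insert 0 ((univ.image fun x : Fˣ => x ^ k).image (fun x : Fˣ => (x : F))) := by
    ext y
    simp only [mem_image, mem_univ, true_and, mem_insert]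
    constructor
    · rintro ⟨x, rfl⟩
      by_cases hx : x = 0
      · left; subst hx; simp; omega
      · right; exact ⟨(Units.mk0 x hx) ^ k, ⟨Units.mk0 x hx, rfl⟩, by simp⟩
    · rintro (rfl | ⟨_, ⟨x, rfl⟩, rfl⟩)
      · exact ⟨0, by simp; omega⟩
      · exact ⟨x, by simp⟩
  rw [h2, card_insert_of_notMem, card_image_of_injective _ Units.val_injective]
  · congr 1
    rw [← Set.ncard_coe_finset]
    simp only [coe_image, coe_univ, Set.image_univ]
    rfl
  · simp

lemma exists_order {F : Type*} [Field F] [Fintype F] (k l : ℕ) (hl : l.Prime)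
    (h : l ∣ (Fintype.card F - 1) / Nat.gcd k (Fintype.card F - 1)) :
    ∃ a : F, NP k a ∧ ∑ i ∈ range l, a ^ i = 0 := by
  classical
  have h1 : Nat.card (powMonoidHom k : Fˣ →* Fˣ).range =
      (Fintype.card F - 1) / Nat.gcd k (Fintype.card F - 1) := by
    rw [IsCyclic.card_powMonoidHom_range, Nat.card_eq_fintype_card, Fintype.card_units,
      Nat.gcd_comm]
  rw [← h1] at h
  have := Fact.mk hl
  obtain ⟨⟨x, hxm⟩, hx⟩ := exists_prime_orderOf_dvd_card' l h
  rw [Subgroup.orderOf_mk] at hx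
  obtain ⟨y, hy⟩ := hxm
  refine ⟨x, ⟨x.ne_zero, y, by rw [← hy]; simp⟩, ?_⟩
  have hx1 : (x : F) ≠ 1 := by
    intro h1
    rw [Units.val_eq_one] at h1
    rw [h1, orderOf_one] at hx
    exact hl.one_lt.ne hx
  rw [geom_sum_eq hx1]
  have : (x : F) ^ l = 1 := by
    rw [← Units.val_pow_eq_pow_val, ← hx, pow_orderOf_eq_one]; rfl
  simp [this]

lemma all_sums {F : Type*} [Field F] [Fintype F] (p : ℕ) (hp : p.Prime) (hp5 : 5 ≤ p) [CharP F p]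
    (k n d : ℕ) (hk : 1 ≤ k) (hd : d = Nat.gcd k (Fintype.card F - 1))
    (hq : Fintype.card F > d ^ 2)
    (hgcd : Nat.gcd ((Fintype.card F - 1) / d) (p - 1) ≥ 2)
    (hn' : 2 * n > p ^ 2 - 3 * p + 9) (t : F) : RS k (2 * n) t := by
  classical
  obtain ⟨l, hl, hlg⟩ := Nat.exists_prime_and_dvd (n := Nat.gcd ((Fintype.card F - 1) / d) (p - 1))
    (by omega)
  have hl1 : l ∣ (Fintype.card F - 1) / d := hlg.trans (Nat.gcd_dvd_left _ _)
  have hl2 : l ∣ p - 1 := hlg.trans (Nat.gcd_dvd_right _ _)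
  obtain ⟨a, ha, hsum⟩ := exists_order (F := F) k l hl (hd ▸ hl1)
  have hlp : 2 * l ≤ p - 1 := by
    obtain ⟨c, hc⟩ := hl2
    rcases hp.eq_two_or_odd' with h | h
    · omega
    · have hev : 2 ∣ p - 1 := by obtain ⟨e, he⟩ := h; exact ⟨e, by omega⟩
      rcases Nat.lt_or_ge c 2 with h2 | h2
      · interval_cases c
        · omega
        · rw [mul_one] at hc
          rw [hc, Nat.prime_dvd_prime_iff_eq Nat.prime_two hl] at hev
          omega
      · rw [hc]; nlinarith
  have hneg : ∀ x : F, NP k x → RS k (l - 1) (-x) := by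
    intro x hx
    have h := RS.geom ha hx ((range l).erase 0)
    have h0 : 0 ∈ range l := mem_range.2 hl.pos
    rw [card_erase_of_mem h0, card_range] at h
    rw [← add_sum_erase _ _ h0, pow_zero] at hsum
    rw [show -x = x * ∑ i ∈ (range l).erase 0, a ^ i by linear_combination -x * hsum]
    exact h
  have hzl : RS k l (0 : F) := by
    have h := RS.geom ha NP.one (range l)
    rwa [card_range, hsum, mul_zero] at h

  set A : Finset F := univ.image fun x : F => x ^ k with hA
  have hAc : Fintype.card F < #A ^ 2 := by
    rw [hA, card_powers k hk, ← hd]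
    have hdd : d ∣ Fintype.card F - 1 := hd ▸ Nat.gcd_dvd_right _ _
    obtain ⟨h, hh⟩ := hdd
    have hq2 : 2 ≤ Fintype.card F := Fintype.one_lt_card
    have hd0 : 0 < d := by rcases Nat.eq_zero_or_pos d with h0 | h0
                           · rw [h0] at hh; omega
                           · exact h0
    rw [hh, Nat.mul_div_cancel_left _ hd0]
    have h0 : 0 < h := by rcases Nat.eq_zero_or_pos h with h0 | h0
                          · rw [h0] at hh; omega
                          · exact h0
    have hdh : d ≤ h := by
      by_contra! hlt
      have : d * h + d ≤ d * d := by nlinarith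
      have : Fintype.card F = d * h + 1 := by omega
      nlinarith
    have : Fintype.card F = d * h + 1 := by omega
    nlinarith
  have hA1 : ∀ x ∈ A, RL k 1 x := by
    intro x hx
    obtain ⟨y, _, rfl⟩ := mem_image.1 hx
    by_cases h0 : y ^ k = 0
    · exact ⟨0, by omega, by rw [h0]; exact RS.zero⟩
    · exact ⟨1, le_rfl, RS.one ⟨h0, y, rfl⟩⟩
  have hA2 : ∀ x ∈ A, RL k (l - 1) (-x) := by
    intro x hx
    obtain ⟨y, _, rfl⟩ := mem_image.1 hx
    by_cases h0 : y ^ k = 0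
    · exact ⟨0, by omega, by rw [h0, neg_zero]; exact RS.zero⟩
    · exact ⟨l - 1, le_rfl, hneg _ ⟨h0, y, rfl⟩⟩
  obtain ⟨u₁, hu1, u₂, hu2, u₃, hu3, u₄, hu4, v₁, hv1, v₂, hv2, v₃, hv3, v₄, hv4, ht⟩ :=
    glib A hAc (by
      intro x hx y hy
      obtain ⟨x, _, rfl⟩ := mem_image.1 hx
      obtain ⟨y, _, rfl⟩ := mem_image.1 hy
      exact mem_image.2 ⟨x * y, mem_univ _, mul_pow _ _ _⟩) t
  obtain ⟨s, hs, hst⟩ : RL k (1 + 1 + 1 + 1 + (l - 1) + (l - 1) + (l - 1) + (l - 1)) t := by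
    rw [ht]
    exact (((((((hA1 _ hu1).add (hA1 _ hu2)).add (hA1 _ hu3)).add (hA1 _ hu4)).add
      (hA2 _ hv1)).add (hA2 _ hv2)).add (hA2 _ hv3)).add (hA2 _ hv4)
  have hl2' := hl.two_le
  have hsl : s ≤ 4 * l := by omega
  have hbig : (p - 1) * (l - 1) + 4 * l ≤ 2 * n := by
    obtain ⟨r, rfl⟩ : ∃ r, p = r + 5 := ⟨p - 5, by omega⟩
    obtain ⟨j, rfl⟩ : ∃ j, l = j + 2 := ⟨l - 2, by omega⟩
    have e : (r + 5) ^ 2 - 3 * (r + 5) = r ^ 2 + 7 * r + 10 := by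
      rw [Nat.sub_eq_iff_eq_add (by nlinarith)]; ring
    rw [e] at hn'
    have e2 : r + 5 - 1 = r + 4 := by omega
    have e3 : j + 2 - 1 = j + 1 := by omega
    rw [e2] at hlp
    rw [e2, e3]
    have : 2 * j ≤ r := by omega
    nlinarith [Nat.mul_le_mul_left (r + 8) this]
  have hle : s ≤ 2 * n := by omega
  obtain ⟨b, c, hbc⟩ := Nat.exists_add_mul_eq_of_gcd_dvd_of_mul_pred_le p l (2 * n - s)
    (by
      have : p.gcd l = 1 := (Nat.coprime_primes hp hl).2 (by omega)
      rw [this]; exact one_dvd _)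
    (by simp only [Nat.pred_eq_sub_one]; omega)
  have hfin := (((RS.char p).nsmul b).add (hzl.nsmul c)).add hst
  rw [hbc, Nat.sub_add_cancel hle] at hfin
  simpa using hfin

lemma RS.split {F : Type*} [Field F] {k n : ℕ} {t : F} (h : RS k (2 * n) t) :
    ∃ x y : Fin n → F, (∀ i, NP k (x i)) ∧ (∀ i, NP k (y i)) ∧ ∑ i, x i + ∑ i, y i = t := by
  obtain ⟨s, h1, h2, rfl⟩ := h
  obtain ⟨L, rfl⟩ : ∃ L : List F, s = (L : Multiset F) := ⟨s.toList, by simp⟩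
  have hL : L.length = n + n := by rw [← two_mul]; simpa using h1
  let f : Fin (n + n) → F := fun i => L.get (i.cast hL.symm)
  refine ⟨fun i => f (Fin.castAdd n i), fun i => f (Fin.natAdd n i),
    fun i => h2 _ (by simp [f]), fun i => h2 _ (by simp [f]), ?_⟩
  rw [← Fin.sum_univ_add f, Multiset.sum_coe]
  rw [← Equiv.sum_comp (finCongr hL) f]
  conv_rhs => rw [← List.ofFn_get L, List.sum_ofFn]
  rfl

end W16

namespace W16
open Finset

/-- exponential sum over a finite set -/
noncomputable def ES {K : Type*} [Field K] (ψ : AddChar K ℂ) (B : Finset K) (a : K) : ℂ :=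
  ∑ x ∈ B, ψ (a * x)

lemma ES_sum {K : Type*} [Field K] [Fintype K] [DecidableEq K] (ψ : AddChar K ℂ)
    (hψ : ψ.IsPrimitive) (B : Finset K) (h0 : 0 ∉ B) : ∑ a, ES ψ B a = 0 := by
  unfold ES
  rw [sum_comm]
  apply sum_eq_zero
  intro x hx
  rw [AddChar.sum_mulShift x hψ, if_neg (by rintro rfl; exact h0 hx), Nat.cast_zero]

lemma ES_sq {K : Type*} [Field K] [Fintype K] [DecidableEq K] (ψ : AddChar K ℂ)
    (hψ : ψ.IsPrimitive) (B : Finset K) :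
    ∑ a, ‖ES ψ B a‖ ^ 2 = (Fintype.card K : ℝ) * #B := by
  have h1 : ∀ a, ((‖ES ψ B a‖ ^ 2 : ℝ) : ℂ) = ∑ x ∈ B, ∑ y ∈ B, ψ (a * (x - y)) := by
    intro a
    push_cast
    rw [← Complex.mul_conj']
    unfold ES
    rw [map_sum, sum_mul_sum]
    refine sum_congr rfl fun x _ => sum_congr rfl fun y _ => ?_
    rw [← AddChar.map_neg_eq_conj, ← AddChar.map_add_eq_mul]
    congr 1; ring
  have h2 : ((∑ a, ‖ES ψ B a‖ ^ 2 : ℝ) : ℂ) = (Fintype.card K : ℂ) * #B := by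
    rw [Complex.ofReal_sum]
    simp_rw [h1]
    rw [sum_comm]
    have : ∀ x ∈ B, ∑ a, ∑ y ∈ B, ψ (a * (x - y)) = Fintype.card K := by
      intro x hx
      rw [sum_comm]
      simp_rw [AddChar.sum_mulShift _ hψ, sub_eq_zero]
      simp [hx]
    rw [sum_congr rfl this]
    simp [mul_comm]
  exact_mod_cast h2

lemma ES_zero {K : Type*} [Field K] (ψ : AddChar K ℂ) (B : Finset K) : ES ψ B 0 = #B := by
  simp [ES]

lemma ES_inv {K : Type*} [Field K] [DecidableEq K] (ψ : AddChar K ℂ) (H : Finset K)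
    (h0 : 0 ∉ H) (hmul : ∀ x ∈ H, ∀ y ∈ H, x * y ∈ H) (a u : K) (hu : u ∈ H) :
    ES ψ H (a * u) = ES ψ H a := by
  have hu0 : u ≠ 0 := by rintro rfl; exact h0 hu
  have him : H.image (u * ·) = H := by
    apply eq_of_subset_of_card_le
    · intro x hx
      obtain ⟨y, hy, rfl⟩ := mem_image.1 hx
      exact hmul _ hu _ hy
    · rw [card_image_of_injective _ (mul_right_injective₀ hu0)]
  unfold ES
  conv_rhs => rw [← him]
  rw [sum_image (fun x _ y _ h => mul_right_injective₀ hu0 h)]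
  simp [mul_assoc]

/-- the Gauss-type bound for multiplicative subgroups -/
lemma ES_bound {K : Type*} [Field K] [Fintype K] [DecidableEq K] (ψ : AddChar K ℂ)
    (hψ : ψ.IsPrimitive) (H : Finset K) (h0 : 0 ∉ H) (h1 : 1 ∈ H)
    (hmul : ∀ x ∈ H, ∀ y ∈ H, x * y ∈ H)
    (d : ℕ) (hd : d * #H + 1 = Fintype.card K) (b : K) (hb : b ≠ 0) :
    d * ‖ES ψ H b‖ ≤ (d - 1) * √(Fintype.card K) + 1 := by
  set Q : ℝ := (Fintype.card K : ℝ) with hQ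
  set h : ℝ := (#H : ℝ) with hh
  have hpos : 0 < h := by rw [hh]; exact_mod_cast card_pos.2 ⟨1, h1⟩
  have hdQ : (d : ℝ) * h + 1 = Q := by rw [hh, hQ]; exact_mod_cast hd
  have hQ1 : 1 < Q := by rw [hQ]; exact_mod_cast Fintype.one_lt_card
  have hd1 : (1 : ℝ) ≤ d := by
    have : d ≠ 0 := by rintro rfl; norm_num at hdQ; linarith
    exact_mod_cast Nat.one_le_iff_ne_zero.2 this
  let T : K → ℂ := fun a => d * ES ψ H a + 1
  let U : Finset K := univ.erase 0
  have hUc : (#U : ℝ) = d * h := by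
    have : #U = d * #H := by simp only [U, card_erase_of_mem (mem_univ _), card_univ]; omega
    rw [this]; push_cast; rfl
  have hS0 : ∑ a ∈ U, ES ψ H a = -(h : ℂ) := by
    have h2 := ES_sum ψ hψ H h0
    rw [← add_sum_erase _ _ (mem_univ 0), ES_zero] at h2
    rw [eq_neg_iff_add_eq_zero, add_comm]; rw [hh]; exact_mod_cast h2
  have hS2 : ∑ a ∈ U, ‖ES ψ H a‖ ^ 2 = Q * h - h ^ 2 := by
    have h2 := ES_sq ψ hψ H
    rw [← add_sum_erase _ _ (mem_univ 0), ES_zero] at h2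
    simp only [Complex.norm_natCast] at h2
    simp only [U]; linarith
  have hT0 : ∑ a ∈ U, T a = 0 := by
    simp only [T]
    rw [sum_add_distrib, ← mul_sum, hS0, sum_const, nsmul_one]
    have : (#U : ℂ) = d * (h : ℂ) := by exact_mod_cast congrArg ((↑) : ℝ → ℂ) hUc
    rw [this]; ring
  have hT2 : ∑ a ∈ U, ‖T a‖ ^ 2 = d * h * (d - 1) * Q := by
    have h3 : ∀ a, ‖T a‖ ^ 2 = d ^ 2 * ‖ES ψ H a‖ ^ 2 + 2 * d * (ES ψ H a).re + 1 := by
      intro a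
      simp only [T, Complex.sq_norm, Complex.normSq_apply]
      simp
      ring
    simp_rw [h3]
    rw [sum_add_distrib, sum_add_distrib, ← mul_sum, ← mul_sum, hS2, ← Complex.re_sum, hS0,
      sum_const, nsmul_one, hUc]
    simp
    rw [← hdQ]; ring
  let C : Finset K := H.image (b * ·)
  have hCU : C ⊆ U := by
    intro x hx
    obtain ⟨y, hy, rfl⟩ := mem_image.1 hx
    have : y ≠ 0 := by rintro rfl; exact h0 hy
    simp [U, hb, this]
  have hCc : #C = #H := card_image_of_injective _ (mul_right_injective₀ hb)
  have hTC : ∀ x ∈ C, T x = T b := by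
    intro x hx
    obtain ⟨y, hy, rfl⟩ := mem_image.1 hx
    simp only [T, ES_inv ψ H h0 hmul b y hy]
  have hsd : ∑ a ∈ U \ C, T a = -(h : ℂ) * T b := by
    have h4 := sum_sdiff (f := T) hCU
    rw [hT0, sum_congr rfl hTC, sum_const, hCc, nsmul_eq_mul] at h4
    rw [eq_neg_of_add_eq_zero_left h4, hh]; push_cast; ring
  have hsd2 : ∑ a ∈ U \ C, ‖T a‖ ^ 2 = d * h * (d - 1) * Q - h * ‖T b‖ ^ 2 := by
    have h4 := sum_sdiff (f := fun a => ‖T a‖ ^ 2) hCU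
    have h6 : ∑ a ∈ C, ‖T a‖ ^ 2 = ∑ a ∈ C, ‖T b‖ ^ 2 :=
      sum_congr rfl (fun x hx => by rw [hTC x hx])
    rw [hT2, h6, sum_const, hCc, nsmul_eq_mul] at h4
    linarith
  have hUCc : (#(U \ C) : ℝ) = d * h - h := by
    rw [card_sdiff_of_subset hCU, Nat.cast_sub (card_le_card hCU), hUc, hCc]
  have hcs : (h * ‖T b‖) ^ 2 ≤ (d * h - h) * (d * h * (d - 1) * Q - h * ‖T b‖ ^ 2) := by
    calc (h * ‖T b‖) ^ 2 = ‖∑ a ∈ U \ C, T a‖ ^ 2 := by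
          rw [hsd, norm_mul, norm_neg, Complex.norm_real, Real.norm_of_nonneg hpos.le]
      _ ≤ (∑ a ∈ U \ C, ‖T a‖) ^ 2 := by gcongr; exact norm_sum_le _ _
      _ ≤ #(U \ C) * ∑ a ∈ U \ C, ‖T a‖ ^ 2 := sq_sum_le_card_mul_sum_sq
      _ = _ := by rw [hUCc, hsd2]
  have hTb : ‖T b‖ ^ 2 ≤ ((d - 1) * √Q) ^ 2 := by
    rw [mul_pow, Real.sq_sqrt (by linarith)]
    have h5 : (h ^ 2 * d) * ‖T b‖ ^ 2 ≤ (h ^ 2 * d) * ((d - 1) ^ 2 * Q) := by nlinarith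
    exact le_of_mul_le_mul_left h5 (by positivity)
  have hTb' : ‖T b‖ ≤ (d - 1) * √Q :=
    le_of_sq_le_sq hTb (mul_nonneg (by linarith) (Real.sqrt_nonneg _))
  calc d * ‖ES ψ H b‖ = ‖T b - 1‖ := by simp [T]
    _ ≤ ‖T b‖ + ‖(1 : ℂ)‖ := norm_sub_le _ _
    _ ≤ _ := by rw [norm_one]; linarith

lemma two_powers {K : Type*} [Field K] [Fintype K] (k : ℕ) (hk : 1 ≤ k)
    (hQk : (k - 1) ^ 4 < Fintype.card K) (lam : K) : ∃ a b : K, lam = a ^ k + b ^ k := by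
  classical
  by_cases hlam : lam = 0
  · exact ⟨0, 0, by rw [hlam, zero_pow (by omega), add_zero]⟩
  by_contra! hno
  set A : Finset K := univ.image fun x : K => x ^ k with hA
  set H := A.erase 0 with hH
  have h0A : (0 : K) ∈ A := mem_image.2 ⟨0, mem_univ _, zero_pow (by omega)⟩
  have h0 : 0 ∉ H := by simp [hH]
  have h1 : (1 : K) ∈ H := by simp only [hH, hA, mem_erase, mem_image]; exact ⟨one_ne_zero, 1, by simp⟩
  have hmulA : ∀ x ∈ A, ∀ y ∈ A, x * y ∈ A := by
    intro x hx y hy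
    obtain ⟨x, _, rfl⟩ := mem_image.1 hx
    obtain ⟨y, _, rfl⟩ := mem_image.1 hy
    exact mem_image.2 ⟨x * y, mem_univ _, mul_pow _ _ _⟩
  have hmul : ∀ x ∈ H, ∀ y ∈ H, x * y ∈ H := by
    intro x hx y hy
    rw [hH, mem_erase] at *
    exact ⟨mul_ne_zero hx.1 hy.1, hmulA _ hx.2 _ hy.2⟩
  set d := Nat.gcd k (Fintype.card K - 1) with hd
  have hd0 : 0 < d := Nat.gcd_pos_of_pos_left _ hk
  have hdk : d ≤ k := Nat.gcd_le_left _ hk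
  have hHc : #A = #H + 1 := (card_erase_add_one h0A).symm
  have hQ1 : 1 < Fintype.card K := Fintype.one_lt_card
  have hdH : d * #H + 1 = Fintype.card K := by
    have h2 := card_powers (F := K) k hk
    rw [← hA, hHc, ← hd] at h2
    rw [Nat.add_right_cancel h2, Nat.mul_div_cancel' (Nat.gcd_dvd_right _ _)]
    omega
  set ψ := AddChar.FiniteField.primitiveChar_to_Complex K
  have hψ : ψ.IsPrimitive := AddChar.FiniteField.primitiveChar_to_Complex_isPrimitive K
  have hcount : ∑ a, ES ψ A a ^ 2 * ES ψ H (a * -lam) = 0 := by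
    have h3 : ∀ a, ES ψ A a ^ 2 * ES ψ H (a * -lam) =
        ∑ x ∈ A, ∑ y ∈ A, ∑ z ∈ H, ψ (a * (x + y - lam * z)) := by
      intro a
      unfold ES
      rw [sq, sum_mul_sum, sum_mul]
      refine sum_congr rfl fun x _ => ?_
      rw [sum_mul]
      refine sum_congr rfl fun y _ => ?_
      rw [mul_sum]
      refine sum_congr rfl fun z _ => ?_
      rw [← AddChar.map_add_eq_mul, ← AddChar.map_add_eq_mul]
      congr 1; ring
    simp_rw [h3]
    rw [sum_comm]
    refine sum_eq_zero fun x hx => ?_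
    rw [sum_comm]
    refine sum_eq_zero fun y hy => ?_
    rw [sum_comm]
    refine sum_eq_zero fun z hz => ?_
    rw [AddChar.sum_mulShift _ hψ, if_neg, Nat.cast_zero]
    intro h4
    obtain ⟨x, _, rfl⟩ := mem_image.1 hx
    obtain ⟨y, _, rfl⟩ := mem_image.1 hy
    obtain ⟨hz0, hz⟩ := mem_erase.1 hz
    obtain ⟨z, _, rfl⟩ := mem_image.1 hz
    apply hno (x / z) (y / z)
    rw [div_pow, div_pow, ← add_div, eq_div_iff hz0]
    exact (sub_eq_zero.1 h4).symm
  set Q : ℝ := (Fintype.card K : ℝ) with hQ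
  set h : ℝ := (#H : ℝ) with hh
  have hpos : 0 < h := by rw [hh]; exact_mod_cast card_pos.2 ⟨1, h1⟩
  have hdQ : (d : ℝ) * h + 1 = Q := by rw [hh, hQ]; exact_mod_cast hdH
  have hd1 : (1 : ℝ) ≤ d := by exact_mod_cast hd0
  have hAr : (#A : ℝ) = h + 1 := by rw [hHc]; push_cast; rfl
  have hsqA : ∑ a ∈ univ.erase 0, ‖ES ψ A a‖ ^ 2 = (h + 1) * ((d - 1) * h) := by
    have h2 := ES_sq ψ hψ A
    rw [← add_sum_erase _ _ (mem_univ 0), ES_zero] at h2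
    simp only [Complex.norm_natCast] at h2
    rw [hAr, ← hQ, ← hdQ] at h2
    linarith
  have hmain : d * ((h + 1) ^ 2 * h) ≤ ((d - 1) * √Q + 1) * ((h + 1) * ((d - 1) * h)) := by
    rw [← add_sum_erase _ _ (mem_univ 0), zero_mul, ES_zero, ES_zero] at hcount
    have h5 : ‖((#A : ℂ)) ^ 2 * (#H : ℂ)‖ = (h + 1) ^ 2 * h := by
      rw [norm_mul, norm_pow, Complex.norm_natCast, Complex.norm_natCast, hAr]
    rw [← h5, eq_neg_of_add_eq_zero_left hcount, norm_neg]
    calc d * ‖∑ a ∈ univ.erase 0, ES ψ A a ^ 2 * ES ψ H (a * -lam)‖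
        ≤ d * ∑ a ∈ univ.erase 0, ‖ES ψ A a ^ 2 * ES ψ H (a * -lam)‖ := by
          gcongr; exact norm_sum_le _ _
      _ = ∑ a ∈ univ.erase 0, ‖ES ψ A a‖ ^ 2 * (d * ‖ES ψ H (a * -lam)‖) := by
          rw [mul_sum]
          refine sum_congr rfl fun a _ => ?_
          rw [norm_mul, norm_pow]; ring
      _ ≤ ∑ a ∈ univ.erase 0, ‖ES ψ A a‖ ^ 2 * ((d - 1) * √Q + 1) := by
          refine sum_le_sum fun a ha => ?_
          gcongr
          exact ES_bound ψ hψ H h0 h1 hmul d hdH _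
            (mul_ne_zero (ne_of_mem_erase ha) (neg_ne_zero.2 hlam))
      _ = _ := by rw [← sum_mul, hsqA, mul_comm]
  have hm2 : (h * (h + 1)) * (d * (h + 1)) ≤ (h * (h + 1)) * (((d - 1) * √Q + 1) * (d - 1)) := by
    linarith
  have hm3 := le_of_mul_le_mul_left hm2 (by positivity)
  have hQpos : 0 < Q := by rw [← hdQ]; positivity
  have hsQ : 0 < √Q := Real.sqrt_pos.2 hQpos
  have hsq := Real.sq_sqrt hQpos.le
  have hm4 : √Q * √Q ≤ √Q * ((d - 1) ^ 2) := by nlinarith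
  have hm5 := le_of_mul_le_mul_left hm4 hsQ
  have hm6 : Q ≤ ((d : ℝ) - 1) ^ 4 := by
    rw [← hsq]
    calc √Q ^ 2 ≤ (((d : ℝ) - 1) ^ 2) ^ 2 := by gcongr
      _ = _ := by ring
  have hm7 : Fintype.card K ≤ (d - 1) ^ 4 := by
    rw [hQ, ← Nat.cast_one, ← Nat.cast_sub hd0] at hm6
    exact_mod_cast hm6
  have hm8 : (d - 1) ^ 4 ≤ (k - 1) ^ 4 := Nat.pow_le_pow_left (by omega) 4
  omega

end W16

namespace W16

lemma scalar_case {F : Type*} [Field F] [Fintype F] (p : ℕ) (hp : p.Prime) [CharP F p]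
    (k n : ℕ) (hk : 1 ≤ k) (hn : 2 ≤ n) (hqn : Fintype.card F ^ n > (k - 1) ^ 4) (c : F) :
    ∃ A B : Matrix (Fin n) (Fin n) F, c • 1 = A ^ k + B ^ k := by
  have := Fact.mk hp
  have : NeZero n := ⟨by omega⟩
  let K := FiniteField.Extension F p n
  have := Fintype.ofFinite K
  have hc : Fintype.card K = Fintype.card F ^ n := by
    rw [← Nat.card_eq_fintype_card, ← Nat.card_eq_fintype_card]
    exact FiniteField.natCard_extension F p n
  obtain ⟨a, b, hab⟩ := two_powers (K := K) k hk (by rw [hc]; exact hqn) (algebraMap F K c)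
  let bs := Module.finBasisOfFinrankEq F K (FiniteField.finrank_extension F p n)
  refine ⟨Algebra.leftMulMatrix bs a, Algebra.leftMulMatrix bs b, ?_⟩
  rw [← map_pow, ← map_pow, ← map_add, ← hab, AlgHom.commutes, Algebra.algebraMap_eq_smul_one]

end W16

theorem stmt16 (p : ℕ) (hp : p.Prime) (hp5 : 5 ≤ p)
    (F : Type*) [Field F] [Fintype F] [CharP F p]
    (k n : ℕ) (hk : 1 ≤ k) (hn : 2 ≤ n) (hpk : ¬ p ∣ k)
    (d : ℕ) (hd : d = Nat.gcd k (Fintype.card F - 1))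
    (hq : Fintype.card F > d ^ 2)
    (hgcd : Nat.gcd ((Fintype.card F - 1) / d) (p - 1) ≥ 2)
    (hn' : 2 * n > p ^ 2 - 3 * p + 9) (hqn : Fintype.card F ^ n > (k - 1) ^ 4) :
    ∀ M : Matrix (Fin n) (Fin n) F, ∃ A B : Matrix (Fin n) (Fin n) F,
      M = A ^ k + B ^ k := by
  intro M
  by_cases hM : ∃ c : F, M = c • 1
  · obtain ⟨c, rfl⟩ := hM
    exact W16.scalar_case p hp k n hk hn hqn c
  · push Not at hM
    obtain ⟨x, y, hx, hy, hxy⟩ :=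
      (W16.all_sums p hp hp5 k n d hk hd hq hgcd hn' M.trace).split
    exact W16.nonscalar p hp k hk hpk M hM x y hx hy hxy
end

section
/- Set d := gcd(k, q−1) and suppose p does not divide k and every element of 𝔽_q is a sum of d elements of 𝔽_q each of which is a d-th power. (i) If q ≥ 3d+1 and either d = 2 or (d > 2, 2n > d−1, and q^n > (k−1)^4), then every matrix in M_n(𝔽_q) can be written as A^k + B^k with A, B ∈ M_n(𝔽_q). (ii) If q = 2d+1 and either d = 2 or (d > 2, n > 2d−1, and q^n > (k−1)^4), then the same conclusion holds. -/
lemma jac_norm {E : Type*} [Field E] [Fintype E] {χ φ : MulChar E ℂ} (hχ : χ ≠ 1)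
    (hφ : φ ≠ 1) : ‖jacobiSum χ φ‖ ≤ Real.sqrt (Fintype.card E) := by
  have hQ : (1 : ℝ) ≤ Fintype.card E := by exact_mod_cast Fintype.card_pos
  by_cases h : χ * φ = 1
  · have : φ = χ⁻¹ := by rw [← mul_eq_one_iff_eq_inv', h]
    rw [this, jacobiSum_nontrivial_inv hχ, norm_neg]
    refine le_trans ?_ (Real.one_le_sqrt.mpr hQ)
    have h1 : χ (-1) * χ (-1) = 1 := by rw [← map_mul]; simp
    have h2 : ‖χ (-1)‖ * ‖χ (-1)‖ = 1 := by rw [← norm_mul, h1]; simp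
    nlinarith [norm_nonneg (χ (-1))]
  · have hc : ringChar ℂ ≠ ringChar E := by
      obtain ⟨p, hp⟩ := CharP.exists E
      have := CharP.char_ne_zero_of_finite E p
      rw [ringChar.eq E p, ringChar.eq ℂ 0]
      exact this.symm
    have h1 := jacobiSum_mul_jacobiSum_inv hc hχ hφ h
    have h2 : jacobiSum χ⁻¹ φ⁻¹ = star (jacobiSum χ φ) := by
      simp only [jacobiSum, star_sum, star_mul', MulChar.star_apply']
    rw [h2] at h1
    have h3 : ‖jacobiSum χ φ‖ * ‖jacobiSum χ φ‖ = Fintype.card E := by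
      have := congrArg norm h1
      rw [norm_mul, norm_star] at this
      simpa using this
    apply le_of_eq
    rw [← h3, Real.sqrt_mul_self (norm_nonneg _)]

lemma weil_sum {E : Type*} [Field E] [Fintype E] (k : ℕ) (hk : 1 ≤ k)
    (hE : Fintype.card E > (k - 1) ^ 4) (c : E) : ∃ x y : E, c = x ^ k + y ^ k := by
  classical
  by_contra hno
  push Not at hno
  have hc0 : c ≠ 0 := fun h => hno 0 0 (by rw [h, zero_pow (by omega), add_zero])
  set Q := Fintype.card E with hQ
  have hQ2 : 1 < Q := Fintype.one_lt_card
  set D := Nat.gcd k (Q - 1) with hD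
  have hDpos : 0 < D := Nat.gcd_pos_of_pos_left _ hk
  have hDk : D ≤ k := Nat.gcd_le_left _ hk
  -- D-th powers are k-th powers
  have hpow : ∀ x : Eˣ, ∃ y : E, ((x : E) ^ D) = y ^ k := by
    intro x
    have hcard : x ^ (Q - 1) = 1 := by
      rw [hQ, ← Fintype.card_units]; exact pow_card_eq_one
    refine ⟨((x ^ (Nat.gcdA k (Q - 1)) : Eˣ) : E), ?_⟩
    have : x ^ D = (x ^ (Nat.gcdA k (Q - 1))) ^ k := by
      rw [← zpow_natCast, ← zpow_natCast, ← zpow_mul, hD, Nat.gcd_eq_gcd_ab, zpow_add, zpow_mul x ((Q - 1 : ℕ) : ℤ),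
        zpow_natCast, hcard, one_zpow, mul_one, mul_comm]
    rw [← Units.val_pow_eq_pow_val, this, Units.val_pow_eq_pow_val]
  obtain ⟨χ, hχ⟩ := MulChar.exists_mulChar_orderOf E (n := D) (R := ℂ) (Nat.gcd_dvd_right k (Q - 1))
    (Complex.isPrimitiveRoot_exp D hDpos.ne')
  -- kernel
  have hker : ∀ u : E, χ u = 1 → ∃ y : E, u = y ^ k := by
    intro u hu
    have hu0 : u ≠ 0 := by rintro rfl; rw [χ.map_zero] at hu; exact zero_ne_one hu
    obtain ⟨g, hg⟩ := IsCyclic.exists_generator (α := Eˣ)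
    obtain ⟨a, ha⟩ := hg (Units.mk0 u hu0)
    simp only at ha
    have hgo : ∀ j : ℕ, χ (g : E) ^ j = 1 → D ∣ j := by
      intro j hj
      rw [← hχ]
      apply orderOf_dvd_of_pow_eq_one
      apply MulChar.ext
      intro v
      obtain ⟨b, hb⟩ := hg v
      simp only at hb
      have h1 : (χ ^ j) g = 1 := by rw [MulChar.pow_apply_coe, hj]
      have h2 : (MulChar.toUnitHom (χ ^ j)) g = 1 := by
        ext; rw [MulChar.coe_toUnitHom, h1]; simp
      rw [← MulChar.coe_toUnitHom, ← hb, map_zpow, h2, MulChar.one_apply_coe]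
      simp
    have hχD : χ ^ D = 1 := by rw [← hχ]; exact pow_orderOf_eq_one χ
    have hfin : 0 < orderOf g := orderOf_pos g
    obtain ⟨a', ha'⟩ : ∃ a' : ℕ, g ^ a' = Units.mk0 u hu0 := by
      have : Units.mk0 u hu0 ∈ Submonoid.powers g := by
        rw [mem_powers_iff_mem_zpowers]; exact ⟨a, ha⟩
      exact this
    have hu' : u = (g : E) ^ a' := by
      rw [← Units.val_pow_eq_pow_val, ha']; rfl
    rw [hu', map_pow] at hu
    obtain ⟨e, he⟩ := hgo a' hu
    obtain ⟨y, hy⟩ := hpow (g ^ e)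
    refine ⟨y, ?_⟩
    rw [← hy, hu', he, mul_comm, pow_mul]; simp
  let G : E → ℂ := fun u => ∑ i ∈ Finset.range D, (χ ^ i) u
  have hχD : χ ^ D = 1 := by rw [← hχ]; exact pow_orderOf_eq_one χ
  have hG : ∀ u : E, G u ≠ 0 → ∃ y : E, u = y ^ k := by
    intro u hu
    apply hker
    by_contra h1
    apply hu
    by_cases hu0 : u = 0
    · subst hu0
      exact Finset.sum_eq_zero fun i _ => (χ ^ i).map_zero
    · have h2 : ∀ i, (χ ^ i) u = (χ u) ^ i := by
        intro i
        exact MulChar.pow_apply_coe χ i (Units.mk0 u hu0)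
      simp only [G, h2]
      rw [geom_sum_eq h1, ← h2, hχD]
      rw [MulChar.one_apply (isUnit_iff_ne_zero.mpr hu0)]; simp
  have hGc : G c = 0 := by
    by_contra h
    obtain ⟨y, hy⟩ := hG c h
    exact hno y 0 (by rw [zero_pow (by omega), add_zero, hy])
  have hzero : ∑ x : E, G (c * x) * G (c * (1 - x)) = 0 := by
    apply Finset.sum_eq_zero
    intro x _
    by_contra h
    obtain ⟨y, hy⟩ := hG _ (left_ne_zero_of_mul h)
    obtain ⟨z, hz⟩ := hG _ (right_ne_zero_of_mul h)
    exact hno y z (by rw [← hy, ← hz]; ring)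
  have hexp : ∑ x : E, G (c * x) * G (c * (1 - x)) =
      ∑ i ∈ Finset.range D, ∑ j ∈ Finset.range D,
        (χ ^ i) c * (χ ^ j) c * jacobiSum (χ ^ i) (χ ^ j) := by
    simp only [G, jacobiSum, Finset.sum_mul_sum]
    simp only [Finset.mul_sum]
    rw [Finset.sum_comm]
    refine Finset.sum_congr rfl fun i _ => ?_
    rw [Finset.sum_comm]
    refine Finset.sum_congr rfl fun j _ => ?_
    refine Finset.sum_congr rfl fun x _ => ?_
    rw [map_mul, map_mul]; ring
  obtain ⟨D', hD'⟩ : ∃ D', D = D' + 1 := ⟨D - 1, by omega⟩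
  have hne : ∀ i ∈ Finset.range D', χ ^ (i + 1) ≠ 1 := by
    intro i hi h
    have := orderOf_dvd_of_pow_eq_one h
    rw [hχ] at this
    have := Nat.le_of_dvd (by omega) this
    simp at hi; omega
  have hc1 : (1 : MulChar E ℂ) c = 1 := MulChar.one_apply (isUnit_iff_ne_zero.mpr hc0)
  have hGc' : ∑ i ∈ Finset.range D', (χ ^ (i + 1)) c = -1 := by
    have : G c = ∑ i ∈ Finset.range D', (χ ^ (i + 1)) c + 1 := by
      simp only [G]; rw [hD', Finset.sum_range_succ', pow_zero, hc1]
    rw [hGc] at this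
    linear_combination -this
  have hmain : (Q : ℂ) + ∑ i ∈ Finset.range D', ∑ j ∈ Finset.range D',
      (χ ^ (i + 1)) c * (χ ^ (j + 1)) c * jacobiSum (χ ^ (i + 1)) (χ ^ (j + 1)) = 0 := by
    rw [← hzero, hexp, hD', Finset.sum_range_succ']
    simp only [Finset.sum_range_succ', pow_zero, hc1, mul_one, one_mul]
    rw [jacobiSum_one_one, Finset.sum_add_distrib]
    have e1 : ∑ i ∈ Finset.range D', (χ ^ (i + 1)) c * jacobiSum (χ ^ (i + 1)) 1 = 1 := by
      rw [Finset.sum_congr rfl (g := fun i => (χ ^ (i + 1)) c * (-1))]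
      · rw [← Finset.sum_mul, hGc']; norm_num
      · intro i hi
        rw [jacobiSum_comm, jacobiSum_one_nontrivial (hne i hi)]
    have e2 : ∑ i ∈ Finset.range D', (χ ^ (i + 1)) c * jacobiSum 1 (χ ^ (i + 1)) = 1 := by
      rw [← e1]
      exact Finset.sum_congr rfl fun i _ => by rw [jacobiSum_comm]
    rw [e1, e2]; ring
  have hn1 : ∀ i, ‖(χ ^ i) c‖ ≤ 1 := by
    intro i
    have h1 : (χ ^ i) c ^ (Q - 1) = 1 := by
      rw [← map_pow, FiniteField.pow_card_sub_one_eq_one c hc0, map_one]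
    have h2 : ‖(χ ^ i) c‖ ^ (Q - 1) = 1 := by rw [← norm_pow, h1, norm_one]
    exact ((pow_eq_one_iff_of_nonneg (norm_nonneg _) (by omega)).mp h2).le
  have hbound : (Q : ℝ) ≤ (D' : ℝ) ^ 2 * Real.sqrt Q := by
    have h0 : (Q : ℂ) = - ∑ i ∈ Finset.range D', ∑ j ∈ Finset.range D',
      (χ ^ (i + 1)) c * (χ ^ (j + 1)) c * jacobiSum (χ ^ (i + 1)) (χ ^ (j + 1)) := by
      linear_combination hmain
    have h1 := congrArg norm h0
    rw [Complex.norm_natCast, norm_neg] at h1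
    refine h1.le.trans ?_
    have h2 : ∀ i ∈ Finset.range D', ‖∑ j ∈ Finset.range D',
      (χ ^ (i + 1)) c * (χ ^ (j + 1)) c * jacobiSum (χ ^ (i + 1)) (χ ^ (j + 1))‖ ≤ D' * Real.sqrt Q := by
      intro i hi
      refine (norm_sum_le_of_le (f := _) _ (n := fun _ => Real.sqrt Q) ?_).trans (by simp)
      intro j hj
      rw [norm_mul, norm_mul]
      have := jac_norm (hne i hi) (hne j hj)
      calc _ ≤ 1 * 1 * Real.sqrt Q := by
            gcongr
            · exact hn1 _
            · exact hn1 _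
        _ = _ := by ring
    refine (norm_sum_le_of_le _ h2).trans ?_
    simp; apply le_of_eq; ring
  have hQpos : (0 : ℝ) < Q := by exact_mod_cast (by omega : 0 < Q)
  have hs := Real.sq_sqrt hQpos.le
  have hs' := Real.sqrt_pos.mpr hQpos
  have h1 : Real.sqrt Q ≤ (D' : ℝ) ^ 2 := by
    by_contra hh
    push Not at hh
    nlinarith
  have h2 : (Q : ℝ) ≤ (D' : ℝ) ^ 4 := by
    calc (Q : ℝ) = Real.sqrt Q ^ 2 := hs.symm
      _ ≤ ((D' : ℝ) ^ 2) ^ 2 := by gcongr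
      _ = _ := by ring
  have h3 : Q ≤ D' ^ 4 := by exact_mod_cast h2
  have h4 : D' ^ 4 ≤ (k - 1) ^ 4 := Nat.pow_le_pow_left (by omega) 4
  omega

open Polynomial in
lemma exists_poly_root {F ι : Type*} [Field F] [DecidableEq ι] (k : ℕ) (hk : (k : F) ≠ 0) (a : ι → F)
    (ha : ∀ i, ∃ b, b ^ k = a i) (h0 : ∀ i j, a i = 0 → a j = 0 → i = j) (s : Finset ι) :
    ∃ r : F[X], (∏ i ∈ s, (X - C (a i))) ∣ r ^ k - X := by
  induction s using Finset.induction_on with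
  | empty => exact ⟨0, by simp⟩
  | insert i s hi ih =>
    obtain ⟨r, e, he⟩ := ih
    rw [Finset.prod_insert hi]
    set g := ∏ i ∈ s, (X - C (a i)) with hg
    by_cases hga : g.eval (a i) = 0
    · have hai : a i ≠ 0 := by
        intro h
        rw [hg, eval_prod, Finset.prod_eq_zero_iff] at hga
        obtain ⟨j, hj, hj'⟩ := hga
        have : a j = 0 := by
          simp only [eval_sub, eval_X, eval_C, sub_eq_zero] at hj'
          rw [← hj', h]
        exact hi (h0 _ _ h this ▸ hj)
      have hra : r.eval (a i) ^ k = a i := by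
        have := congrArg (eval (a i)) he
        simp only [eval_sub, eval_pow, eval_X, eval_mul, hga, zero_mul] at this
        linear_combination this
      have hk0 : k ≠ 0 := by rintro rfl; simp at hk
      have hr0 : r.eval (a i) ≠ 0 := by
        intro h
        rw [h, zero_pow hk0] at hra
        exact hai hra.symm
      set t := - e.eval (a i) / (k * r.eval (a i) ^ (k - 1)) with ht
      refine ⟨r + C t * g, ?_⟩
      obtain ⟨z, hz⟩ := powAddExpansion r (C t * g) k
      have h1 : (r + C t * g) ^ k - X = g * (e + (k : F[X]) * r ^ (k - 1) * C t + z * C t ^ 2 * g) := by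
        rw [hz]
        linear_combination he
      rw [h1, mul_comm (X - C (a i))]
      apply mul_dvd_mul_left
      rw [dvd_iff_isRoot]
      simp only [IsRoot, eval_add, eval_mul, eval_C, eval_pow, hga, eval_natCast, mul_zero, add_zero]
      rw [ht]
      have := pow_ne_zero (k - 1) hr0
      field_simp
      ring
    · obtain ⟨b, hb⟩ := ha i
      refine ⟨r + C ((b - r.eval (a i)) / g.eval (a i)) * g, ?_⟩
      apply IsCoprime.mul_dvd
      · rw [(irreducible_X_sub_C (a i)).coprime_iff_not_dvd, dvd_iff_isRoot]
        exact hga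
      · rw [dvd_iff_isRoot]
        simp only [IsRoot, eval_add, eval_mul, eval_C, eval_pow, eval_sub, eval_X]
        rw [div_mul_cancel₀ _ hga, add_sub_cancel, hb, sub_self]
      · obtain ⟨z, hz⟩ := powAddExpansion r (C ((b - r.eval (a i)) / g.eval (a i)) * g) k
        rw [hz]
        set t := C ((b - r.eval (a i)) / g.eval (a i))
        exact ⟨e + (k : F[X]) * r ^ (k - 1) * t + z * t ^ 2 * g, by linear_combination he⟩

lemma upper_pow {F : Type*} [Field F] {n k : ℕ} (hk : (k : F) ≠ 0) (U : Matrix (Fin n) (Fin n) F)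
    (hU : ∀ i j, j < i → U i j = 0)
    (ha : ∀ i, ∃ b, b ^ k = U i i) (h0 : ∀ i j, U i i = 0 → U j j = 0 → i = j) :
    ∃ A : Matrix (Fin n) (Fin n) F, U = A ^ k := by
  obtain ⟨r, hr⟩ := exists_poly_root k hk (fun i => U i i) ha h0 Finset.univ
  have h1 : U.charpoly = ∏ i, (Polynomial.X - Polynomial.C (U i i)) :=
    Matrix.charpoly_of_isUpperTriangular U (fun i j h => hU i j h)
  rw [← h1] at hr
  obtain ⟨e, he⟩ := hr
  have := congrArg (Polynomial.aeval U) he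
  simp only [map_sub, map_pow, map_mul, Matrix.aeval_self_charpoly, zero_mul, Polynomial.aeval_X] at this
  exact ⟨_, (sub_eq_zero.mp this).symm⟩

lemma lower_pow {F : Type*} [Field F] {n k : ℕ} (hk : (k : F) ≠ 0) (U : Matrix (Fin n) (Fin n) F)
    (hU : ∀ i j, i < j → U i j = 0)
    (ha : ∀ i, ∃ b, b ^ k = U i i) (h0 : ∀ i j, U i i = 0 → U j j = 0 → i = j) :
    ∃ A : Matrix (Fin n) (Fin n) F, U = A ^ k := by
  obtain ⟨A, hA⟩ := upper_pow hk U.transpose (fun i j h => hU j i h) ha h0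
  exact ⟨A.transpose, by rw [← Matrix.transpose_pow, ← hA, Matrix.transpose_transpose]⟩

/-- conjugacy of matrices -/
def Cj {F : Type*} [Field F] {n : ℕ} (M N : Matrix (Fin n) (Fin n) F) : Prop :=
  ∃ P Q : Matrix (Fin n) (Fin n) F, P * Q = 1 ∧ Q * P = 1 ∧ N = P * M * Q

lemma Cj.trans {F : Type*} [Field F] {n : ℕ} {M N K : Matrix (Fin n) (Fin n) F}
    (h : Cj M N) (h' : Cj N K) : Cj M K := by
  obtain ⟨P, Q, h1, h2, rfl⟩ := h
  obtain ⟨P', Q', h1', h2', rfl⟩ := h'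
  refine ⟨P' * P, Q * Q', ?_, ?_, by simp only [Matrix.mul_assoc]⟩
  · rw [Matrix.mul_assoc, ← Matrix.mul_assoc P, h1, Matrix.one_mul, h1']
  · rw [Matrix.mul_assoc, ← Matrix.mul_assoc Q', h2', Matrix.one_mul, h2]

lemma Cj.trace {F : Type*} [Field F] {n : ℕ} {M N : Matrix (Fin n) (Fin n) F}
    (h : Cj M N) : N.trace = M.trace := by
  obtain ⟨P, Q, h1, h2, rfl⟩ := h
  rw [Matrix.trace_mul_comm, ← Matrix.mul_assoc, h2, Matrix.one_mul]

lemma Cj.pow {F : Type*} [Field F] {n k : ℕ} {M N : Matrix (Fin n) (Fin n) F}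
    (h : Cj M N) (hN : ∃ A B, N = A ^ k + B ^ k) : ∃ A B, M = A ^ k + B ^ k := by
  obtain ⟨P, Q, h1, h2, h3⟩ := h
  obtain ⟨A, B, hAB⟩ := hN
  have key : ∀ (A : Matrix (Fin n) (Fin n) F) (k : ℕ), (Q * A * P) ^ k = Q * A ^ k * P := by
    intro A k
    induction k with
    | zero => simp [h2]
    | succ k ih =>
      rw [pow_succ, ih, pow_succ]
      calc Q * A ^ k * P * (Q * A * P) = Q * A ^ k * (P * Q) * A * P := by
            simp only [Matrix.mul_assoc]
        _ = _ := by rw [h1]; simp only [Matrix.mul_assoc, Matrix.mul_one]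
  refine ⟨Q * A * P, Q * B * P, ?_⟩
  rw [key, key, ← Matrix.add_mul, ← Matrix.mul_add, ← hAB, h3]
  calc M = (Q * P) * M * (Q * P) := by rw [h2]; simp
    _ = _ := by simp only [Matrix.mul_assoc]

/-- conjugation by a row operation -/
lemma Cj.vec {F : Type*} [Field F] {n : ℕ} (M : Matrix (Fin n) (Fin n) F) (i0 : Fin n)
    (y : Fin n → F) (hy : y i0 = 0) :
    ∃ N, Cj M N ∧ N i0 i0 = M i0 i0 + ∑ j, y j * M j i0 ∧
      (∀ i j, i ≠ i0 → N i j = M i j - M i i0 * y j) ∧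
      ∀ j, N i0 j = M i0 j + ∑ l, y l * M l j - (M i0 i0 + ∑ l, y l * M l i0) * y j := by
  classical
  let E : Matrix (Fin n) (Fin n) F := Matrix.vecMulVec (Pi.single i0 1) y
  have hE : E * E = 0 := by
    simp only [E, Matrix.vecMulVec_mul_vecMulVec]
    simp [hy]
  refine ⟨(1 + E) * M * (1 - E), ⟨1 + E, 1 - E, ?_, ?_, rfl⟩, ?_, ?_, ?_⟩
  · noncomm_ring; rw [hE]; simp
  · noncomm_ring; rw [hE]; simp
  · have h1 : ∀ A : Matrix (Fin n) (Fin n) F, (A * E) i0 i0 = 0 := by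
      intro A
      simp [E, Matrix.mul_apply, Matrix.vecMulVec_apply, hy]
    rw [mul_sub, Matrix.sub_apply, h1, mul_one, add_mul, one_mul, sub_zero]
    simp [E, Matrix.mul_apply, Matrix.vecMulVec_apply]
  · intro i j hi
    have h1 : ∀ A : Matrix (Fin n) (Fin n) F, (E * A) i j = 0 := by
      intro A
      simp [E, Matrix.mul_apply, Matrix.vecMulVec_apply, hi]
    rw [add_mul, add_mul, one_mul, Matrix.add_apply, Matrix.mul_assoc E, h1, add_zero, mul_sub, mul_one, Matrix.sub_apply]
    congr 1
    rw [Matrix.mul_apply, Finset.sum_eq_single i0]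
    · simp [E, Matrix.vecMulVec_apply]
    · intro b _ hb
      simp [E, Matrix.vecMulVec_apply, hb]
    · simp
  · intro j
    have h1 : ∀ j, ((1 + E) * M) i0 j = M i0 j + ∑ l, y l * M l j := by
      intro j
      rw [add_mul, one_mul, Matrix.add_apply]
      simp [E, Matrix.mul_apply, Matrix.vecMulVec_apply]
    rw [mul_sub, mul_one, Matrix.sub_apply, h1]
    congr 1
    rw [Matrix.mul_apply, Finset.sum_eq_single i0]
    · rw [h1]; simp [E, Matrix.vecMulVec_apply]
    · intro b _ hb
      simp [E, Matrix.vecMulVec_apply, hb]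
    · simp

lemma Cj.perm {F : Type*} [Field F] {n : ℕ} (M : Matrix (Fin n) (Fin n) F)
    (σ : Equiv.Perm (Fin n)) : Cj M (M.submatrix σ σ) := by
  classical
  refine ⟨(1 : Matrix (Fin n) (Fin n) F).submatrix σ id,
    (1 : Matrix (Fin n) (Fin n) F).submatrix id σ, ?_, ?_, ?_⟩
  · ext i j
    simp [Matrix.mul_apply, Matrix.one_apply]
  · rw [mul_eq_one_comm]
    ext i j
    simp [Matrix.mul_apply, Matrix.one_apply]
  · ext i j
    simp [Matrix.mul_apply, Matrix.one_apply]

lemma Cj.block {F : Type*} [Field F] {n : ℕ} (M : Matrix (Fin (n + 1)) (Fin (n + 1)) F)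
    (N' : Matrix (Fin n) (Fin n) F) (h : Cj (M.submatrix Fin.succ Fin.succ) N') :
    ∃ N, Cj M N ∧ N 0 0 = M 0 0 ∧ ∀ i j : Fin n, N i.succ j.succ = N' i j := by
  obtain ⟨P, Q, h1, h2, rfl⟩ := h
  let ex : Matrix (Fin n) (Fin n) F → Matrix (Fin (n + 1)) (Fin (n + 1)) F := fun P =>
    Matrix.of (Fin.cons (Fin.cons 1 0) (fun i => Fin.cons 0 (P i)))
  have hex : ∀ A B : Matrix (Fin n) (Fin n) F, A * B = 1 → ex A * ex B = 1 := by
    intro A B hAB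
    ext i j
    rw [Matrix.mul_apply, Fin.sum_univ_succ]
    refine Fin.cases ?_ (fun i => ?_) i <;> refine Fin.cases ?_ (fun j => ?_) j
    · simp [ex]
    · simp [ex, (Fin.succ_ne_zero j).symm]
    · simp [ex]
    · have := congrFun (congrFun hAB i) j
      rw [Matrix.mul_apply] at this
      simp [ex, this, Matrix.one_apply]
  refine ⟨ex P * M * ex Q, ⟨ex P, ex Q, hex _ _ h1, hex _ _ h2, rfl⟩, ?_, ?_⟩
  · simp [ex, Matrix.mul_apply, Fin.sum_univ_succ]
  · intro i j
    simp [ex, Matrix.mul_apply, Fin.sum_univ_succ]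

lemma exists_offdiag {F : Type*} [Field F] {n : ℕ} (M : Matrix (Fin (n + 2)) (Fin (n + 2)) F)
    (hM : ∀ c : F, M ≠ c • (1 : Matrix (Fin (n + 2)) (Fin (n + 2)) F)) :
    ∃ N, Cj M N ∧ N 1 0 ≠ 0 := by
  have key : ∀ K : Matrix (Fin (n + 2)) (Fin (n + 2)) F, (∃ i j, i ≠ j ∧ K i j ≠ 0) →
      ∃ N, Cj K N ∧ N 1 0 ≠ 0 := by
    rintro K ⟨i, j, hij, hK⟩
    let τ := Equiv.swap 0 j
    have hi' : τ i ≠ 0 := by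
      intro h
      have : i = τ 0 := by rw [← h]; simp [τ]
      simp [τ] at this
      exact hij this
    refine ⟨_, Cj.perm K (τ * Equiv.swap 1 (τ i)), ?_⟩
    have h0 : (τ * Equiv.swap 1 (τ i)) 0 = j := by
      rw [Equiv.Perm.mul_apply, Equiv.swap_apply_of_ne_of_ne (by simp) hi'.symm]
      simp [τ]
    have h1 : (τ * Equiv.swap 1 (τ i)) 1 = i := by
      rw [Equiv.Perm.mul_apply, Equiv.swap_apply_left]
      simp [τ]
    rw [Matrix.submatrix_apply, h0, h1]
    exact hK
  by_cases h : ∃ i j, i ≠ j ∧ M i j ≠ 0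
  · exact key M h
  push Not at h
  obtain ⟨i, hi⟩ : ∃ i, M i i ≠ M 0 0 := by
    by_contra hcon
    push Not at hcon
    apply hM (M 0 0)
    ext i j
    by_cases hij : i = j
    · subst hij; simp [hcon]
    · simp [h i j hij, hij]
  have hi0 : i ≠ 0 := by rintro rfl; exact hi rfl
  obtain ⟨N, hMN, -, -, hN⟩ := Cj.vec M 0 (Pi.single i 1) (by simp [hi0])
  obtain ⟨K, hNK, hK⟩ := key N ⟨0, i, hi0.symm, by
    rw [hN i]
    simp only [Pi.single_apply, ite_mul, one_mul, zero_mul, Finset.sum_ite_eq', Finset.mem_univ, if_true]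
    rw [h 0 i hi0.symm, h i 0 hi0]
    simpa [sub_eq_zero] using hi⟩
  exact ⟨K, hMN.trans hNK, hK⟩

lemma exists_diag {F : Type*} [Field F] (n : ℕ) : ∀ (M : Matrix (Fin (n + 1)) (Fin (n + 1)) F)
    (a : Fin (n + 1) → F)
    (_ : n = 0 ∨ ∀ c : F, M ≠ c • (1 : Matrix (Fin (n + 1)) (Fin (n + 1)) F))
    (_ : M.trace = ∑ i, a i), ∃ N, Cj M N ∧ ∀ i, N i i = a i := by
  induction n with
  | zero =>
    intro M a _ ht
    refine ⟨M, ⟨1, 1, by simp, by simp, by simp⟩, ?_⟩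
    intro i
    obtain rfl : i = 0 := Fin.eq_zero i
    simpa [Matrix.trace] using ht
  | succ n ih =>
    intro M a hM ht
    obtain ⟨N, hMN, hN⟩ := exists_offdiag M (hM.resolve_left (by omega))
    have step : ∃ K, Cj M K ∧ K 0 0 = a 0 ∧ (n = 0 ∨ ∀ c : F, K.submatrix Fin.succ Fin.succ ≠
        c • (1 : Matrix (Fin (n + 1)) (Fin (n + 1)) F)) := by
      obtain ⟨K, hNK, hK0, hK1, -⟩ := Cj.vec N 0 (Pi.single 1 ((a 0 - N 0 0) / N 1 0)) (by simp)
      have hK00 : K 0 0 = a 0 := by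
        rw [hK0]
        simp only [Pi.single_apply, ite_mul, zero_mul, Finset.sum_ite_eq', Finset.mem_univ, if_true]
        field_simp
        ring
      have hK10 : K 1 0 ≠ 0 := by
        rw [hK1 1 0 (by simp)]
        simpa using hN
      by_cases hgood : n = 0 ∨ ∀ c : F, K.submatrix Fin.succ Fin.succ ≠
        c • (1 : Matrix (Fin (n + 1)) (Fin (n + 1)) F)
      · exact ⟨K, hMN.trans hNK, hK00, hgood⟩
      push Not at hgood
      obtain ⟨hn, c, hc⟩ := hgood
      obtain ⟨n, rfl⟩ := Nat.exists_eq_succ_of_ne_zero hn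
      obtain ⟨L, hKL, hL0, hL1, -⟩ := Cj.vec K 0
        (Pi.single 1 (- K 2 0 / K 1 0) + Pi.single 2 1) (by
          have : (0 : Fin (n + 1 + 1 + 1)) ≠ 2 := by
            intro h; have := congrArg Fin.val h; simp at this; rw [Nat.mod_eq_of_lt (by omega)] at this; omega
          simp [this])
      have h21 : (2 : Fin (n + 1 + 1 + 1)) ≠ 1 := by
        intro h; have := congrArg Fin.val h; simp at this; rw [Nat.mod_eq_of_lt (by omega)] at this; omega
      refine ⟨L, (hMN.trans hNK).trans hKL, ?_, Or.inr ?_⟩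
      · rw [hL0, hK00]
        simp only [Pi.add_apply, add_mul, Finset.sum_add_distrib]
        simp only [Pi.single_apply, ite_mul, zero_mul, Finset.sum_ite_eq', Finset.mem_univ, if_true]
        field_simp
        ring
      · intro c' hc'
        have e1 := congrFun (congrFun hc 0) 1
        have e2 := congrFun (congrFun hc' 0) 1
        simp only [Matrix.submatrix_apply, Matrix.smul_apply, Matrix.one_apply] at e1 e2
        have e3 : (Fin.succ 1 : Fin (n + 1 + 1 + 1)) = 2 := rfl
        have e4 : (Fin.succ 0 : Fin (n + 1 + 1 + 1)) = 1 := rfl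
        rw [e3, e4] at e1 e2
        rw [hL1 1 2 (by simp)] at e2
        simp [h21] at e1 e2
        rw [e1] at e2
        simp at e2
        exact hK10 e2
    obtain ⟨K, hMK, hK0, hK⟩ := step
    have htr : (K.submatrix Fin.succ Fin.succ).trace = ∑ i : Fin (n + 1), a i.succ := by
      have h1 := hMK.trace
      rw [ht, Matrix.trace, Fin.sum_univ_succ, Fin.sum_univ_succ (f := a)] at h1
      simp only [Matrix.diag_apply] at h1
      rw [hK0] at h1
      simpa [Matrix.trace] using add_left_cancel h1
    obtain ⟨N', hN', hd⟩ := ih _ _ hK htr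
    obtain ⟨L, hKL, hL0, hL⟩ := Cj.block K N' hN'
    refine ⟨L, hMK.trans hKL, ?_⟩
    intro i
    refine Fin.cases ?_ (fun i => ?_) i
    · rw [hL0, hK0]
    · rw [hL, hd]

lemma nonscalar_case {F : Type*} [Field F] {n k : ℕ} (hn : 1 ≤ n) (hk : (k : F) ≠ 0)
    (M : Matrix (Fin n) (Fin n) F)
    (hM : ∀ c : F, M ≠ c • (1 : Matrix (Fin n) (Fin n) F)) (f g : Fin n → F)
    (hf : ∀ i, ∃ b, b ^ k = f i) (hg : ∀ i, ∃ b, b ^ k = g i)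
    (hf0 : ∀ i j, f i = 0 → f j = 0 → i = j) (hg0 : ∀ i j, g i = 0 → g j = 0 → i = j)
    (ht : M.trace = ∑ i, f i + ∑ i, g i) : ∃ A B, M = A ^ k + B ^ k := by
  obtain ⟨n, rfl⟩ := Nat.exists_eq_add_of_le' hn
  obtain ⟨N, hMN, hN⟩ := exists_diag n M (fun i => f i + g i) (Or.inr hM)
    (by rw [ht, Finset.sum_add_distrib])
  apply hMN.pow
  obtain ⟨A, hA⟩ := lower_pow hk (Matrix.of fun i j => if i < j then 0 else if i = j then f i else N i j)
    (by intro i j h; simp [h]) (by simpa using hf) (by simpa using hf0)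
  obtain ⟨B, hB⟩ := upper_pow hk (Matrix.of fun i j => if j < i then 0 else if i = j then g i else N i j)
    (by intro i j h; simp [h]) (by simpa using hg) (by simpa using hg0)
  refine ⟨A, B, ?_⟩
  rw [← hA, ← hB]
  ext i j
  rcases lt_trichotomy i j with h | h | h
  · simp [h, h.ne, h.not_gt]
  · subst h; simp [hN]
  · simp [h, h.ne', h.not_gt]

open scoped Pointwise

/-- The standing hypotheses on the multiplicative subgroup `H`. -/
structure GoodH {F : Type*} [Field F] [Fintype F] (H : Finset F) (d : ℕ) : Prop where
  one_mem : (1 : F) ∈ H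
  zero_notMem : (0 : F) ∉ H
  mul_mem : ∀ a ∈ H, ∀ b ∈ H, a * b ∈ H
  inv_mem : ∀ a ∈ H, a⁻¹ ∈ H
  span : ∀ x : F, ∃ f : Fin d → F, (∀ i, f i = 0 ∨ f i ∈ H) ∧ x = ∑ i, f i
  card : d * H.card + 1 = Fintype.card F

/-- Stability under multiplication by `H`. -/
def HInv {F : Type*} [Field F] (H X : Finset F) : Prop := ∀ h ∈ H, ∀ x ∈ X, h * x ∈ X

section
variable {F : Type*} [Field F] [Fintype F] [DecidableEq F] {H : Finset F} {d : ℕ}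

lemma GoodH.ne_zero (hH : GoodH H d) {h : F} (hh : h ∈ H) : h ≠ 0 :=
  fun h0 => hH.zero_notMem (h0 ▸ hh)

lemma GoodH.full (hH : GoodH H d) {A : Finset F} (h0 : 0 ∈ A) (hadd : ∀ x ∈ A, ∀ y ∈ A, x + y ∈ A)
    (hA : HInv H A) {g : F} (hg : g ∈ A) (hg0 : g ≠ 0) : A = Finset.univ := by
  rw [Finset.eq_univ_iff_forall]
  intro x
  obtain ⟨f, hf, hx⟩ := hH.span (x / g)
  have : x = ∑ i, f i * g := by
    rw [← Finset.sum_mul, ← hx, div_mul_cancel₀ _ hg0]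
  rw [this]
  refine Finset.sum_induction _ (· ∈ A) (fun a b ha hb => hadd a ha b hb) h0 ?_
  intro i _
  rcases hf i with h | h
  · rw [h, zero_mul]; exact h0
  · exact hA _ h _ hg

lemma HInv.image {B : Finset F} (hH : GoodH H d) (hB : HInv H B) {h : F} (hh : h ∈ H) :
    B.image (h * ·) = B := by
  apply Finset.eq_of_subset_of_card_le
  · intro x hx
    obtain ⟨b, hb, rfl⟩ := Finset.mem_image.mp hx
    exact hB h hh b hb
  · rw [Finset.card_image_of_injective _ (mul_right_injective₀ (hH.ne_zero hh))]

lemma card_submod (X Y B : Finset F) :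
    ((X ∪ Y) + B).card + ((X ∩ Y) + B).card ≤ (X + B).card + (Y + B).card := by
  rw [Finset.union_add, ← Finset.card_union_add_card_inter (X + B) (Y + B)]
  gcongr
  exact Finset.inter_add_subset

lemma card_translate (X B : Finset F) (y : F) :
    ((X.image (· + y)) + B).card = (X + B).card := by
  have : (X.image (· + y)) + B = (X + B).image (· + y) := by
    ext z
    simp only [Finset.mem_add, Finset.mem_image]
    constructor
    · rintro ⟨_, ⟨x, hx, rfl⟩, b, hb, rfl⟩
      exact ⟨x + b, ⟨x, hx, b, hb, rfl⟩, by ring⟩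
    · rintro ⟨_, ⟨x, hx, b, hb, rfl⟩, rfl⟩
      exact ⟨x + y, ⟨x, hx, rfl⟩, b, hb, by ring⟩
  rw [this, Finset.card_image_of_injective _ (add_left_injective y)]

lemma card_scale (hH : GoodH H d) {B : Finset F} (hB : HInv H B) (X : Finset F) {h : F} (hh : h ∈ H) :
    ((X.image (h * ·)) + B).card = (X + B).card := by
  have : (X.image (h * ·)) + B = (X + B).image (h * ·) := by
    conv_lhs => rw [← hB.image hH hh]
    ext z
    simp only [Finset.mem_add, Finset.mem_image]
    constructor
    · rintro ⟨_, ⟨x, hx, rfl⟩, _, ⟨b, hb, rfl⟩, rfl⟩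
      exact ⟨x + b, ⟨x, hx, b, hb, rfl⟩, by ring⟩
    · rintro ⟨_, ⟨x, hx, b, hb, rfl⟩, rfl⟩
      exact ⟨h * x, ⟨x, hx, rfl⟩, h * b, ⟨b, hb, rfl⟩, by ring⟩
  rw [this, Finset.card_image_of_injective _ (mul_right_injective₀ (hH.ne_zero hh))]

/-- Cauchy-Davenport for `H`-stable summands (isoperimetric method). -/
lemma GoodH.cd (hH : GoodH H d) {B : Finset F} (hB : HInv H B) (hBn : B.Nonempty)
    {X : Finset F} (hX : X.Nonempty) (hXB : X + B ≠ Finset.univ) :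
    X.card + B.card ≤ (X + B).card + 1 := by
  classical
  have hle : ∀ Y : Finset F, Y.card ≤ (Y + B).card := fun Y => Finset.card_le_card_add_right hBn
  let P : Finset (Finset F) := Finset.univ.filter fun Y => Y.Nonempty ∧ Y + B ≠ Finset.univ
  have hP : ∀ Y, Y ∈ P ↔ Y.Nonempty ∧ Y + B ≠ Finset.univ := by intro Y; simp [P]
  obtain ⟨A1, hA1, hmin1⟩ := Finset.exists_min_image P (fun Y => (Y + B).card - Y.card)
    ⟨X, (hP X).2 ⟨hX, hXB⟩⟩
  set α := (A1 + B).card - A1.card with hα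
  have hmin : ∀ Y ∈ P, α + Y.card ≤ (Y + B).card := by
    intro Y hY
    have := hmin1 Y hY
    have := hle Y
    omega
  obtain ⟨A2, hA2, hmin2⟩ := Finset.exists_min_image (P.filter fun Y => (Y + B).card = α + Y.card)
    Finset.card ⟨A1, by
      rw [Finset.mem_filter]; exact ⟨hA1, by have := hle A1; omega⟩⟩
  rw [Finset.mem_filter] at hA2
  obtain ⟨a, ha⟩ := ((hP A2).1 hA2.1).1
  -- translate so that it contains zero
  obtain ⟨A, hA0, hAc, hAB⟩ : ∃ A : Finset F, 0 ∈ A ∧ A.card = A2.card ∧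
      (A + B).card = (A2 + B).card :=
    ⟨A2.image (· + (-a)), Finset.mem_image.mpr ⟨a, ha, by ring⟩,
      Finset.card_image_of_injective _ (add_left_injective _), card_translate _ _ _⟩
  have hcu : ∀ Y : Finset F, Y ≠ Finset.univ ↔ Y.card < Fintype.card F := by
    intro Y; rw [Finset.card_lt_iff_ne_univ]
  have hlt : (A + B).card < Fintype.card F := by
    rw [hAB, ← hcu]; exact ((hP A2).1 hA2.1).2
  have hAα : (A + B).card = α + A.card := by rw [hAB, hAc, hA2.2]
  have hminA : ∀ Y ∈ P, (Y + B).card = α + Y.card → A.card ≤ Y.card := by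
    intro Y hY h
    rw [hAc]
    exact hmin2 Y (Finset.mem_filter.mpr ⟨hY, h⟩)
  have hApos : 0 < A.card := Finset.card_pos.mpr ⟨0, hA0⟩
  -- duality
  have hdual : 2 * A.card + α ≤ Fintype.card F := by
    let Z : Finset F := ((A + B)ᶜ).image (fun x => -x)
    have hZc : Z.card = Fintype.card F - (A + B).card := by
      rw [Finset.card_image_of_injective _ neg_injective, Finset.card_compl]
    have hZB : Z + B ⊆ (Aᶜ).image (fun x => -x) := by
      intro z hz
      obtain ⟨y, hy, b, hb, rfl⟩ := Finset.mem_add.mp hz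
      obtain ⟨x, hx, rfl⟩ := Finset.mem_image.mp hy
      refine Finset.mem_image.mpr ⟨x - b, ?_, by ring⟩
      rw [Finset.mem_compl] at hx ⊢
      intro h
      exact hx (Finset.mem_add.mpr ⟨x - b, h, b, hb, by ring⟩)
    have hZBc := Finset.card_le_card hZB
    rw [Finset.card_image_of_injective _ neg_injective, Finset.card_compl] at hZBc
    have hZP : Z ∈ P := by
      rw [hP, hcu]
      exact ⟨Finset.card_pos.mp (by omega), by omega⟩
    have h1 := hmin Z hZP
    have h2 := hminA Z hZP (by omega)
    omega
  have hdisj : ∀ A' : Finset F, A'.card = A.card → (A' + B).card = (A + B).card →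
      (A ∩ A').Nonempty → A' = A := by
    intro A' hc hcB hne
    by_contra hneq
    have hI : (A ∩ A').card < A.card := by
      by_contra hcon
      push Not at hcon
      have h1 : A ∩ A' = A := Finset.eq_of_subset_of_card_le Finset.inter_subset_left hcon
      have h2 : A ⊆ A' := Finset.inter_eq_left.mp h1
      exact hneq (Finset.eq_of_subset_of_card_le h2 hc.le).symm
    have hIB : ((A ∩ A') + B).card ≤ (A + B).card :=
      Finset.card_le_card (Finset.add_subset_add_right Finset.inter_subset_left)
    have hIP : A ∩ A' ∈ P := by
      rw [hP, hcu]; exact ⟨hne, by omega⟩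
    have h1 := hmin _ hIP
    have h2 : ((A ∩ A') + B).card ≠ α + (A ∩ A').card := by
      intro h
      have := hminA _ hIP h
      omega
    have h3 := card_submod A A' B
    have h4 := Finset.card_union_add_card_inter A A'
    have h5 := Finset.card_pos.mpr hne
    have hUP : A ∪ A' ∈ P := by
      rw [hP, hcu]
      exact ⟨⟨0, Finset.mem_union_left _ hA0⟩, by omega⟩
    have h6 := hmin _ hUP
    omega
  have hadd : ∀ x ∈ A, ∀ y ∈ A, x + y ∈ A := by
    intro x hx y hy
    have := hdisj (A.image (· + y)) (Finset.card_image_of_injective _ (add_left_injective _))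
      (card_translate _ _ _) ⟨y, Finset.mem_inter.mpr ⟨hy, Finset.mem_image.mpr ⟨0, hA0, by ring⟩⟩⟩
    rw [← this]
    exact Finset.mem_image_of_mem _ hx
  have hmul : HInv H A := by
    intro h hh x hx
    have := hdisj (A.image (h * ·))
      (Finset.card_image_of_injective _ (mul_right_injective₀ (hH.ne_zero hh)))
      (card_scale hH hB _ hh) ⟨0, Finset.mem_inter.mpr ⟨hA0, Finset.mem_image.mpr ⟨0, hA0, by ring⟩⟩⟩
    rw [← this]
    exact Finset.mem_image_of_mem _ hx
  have hA1' : A = {0} := by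
    rw [Finset.eq_singleton_iff_unique_mem]
    refine ⟨hA0, fun g hg => ?_⟩
    by_contra hg0
    have := hH.full hA0 hadd hmul hg hg0
    have h1 := hle A
    rw [this, Finset.card_univ] at h1
    rw [this] at hlt
    omega
  have h1 : (A + B).card = B.card := by
    rw [hA1', Finset.singleton_add]
    simp
  have h2 : A.card = 1 := by rw [hA1']; simp
  have := hmin X ((hP X).2 ⟨hX, hXB⟩)
  omega

lemma GoodH.dvd_card (hH : GoodH H d) (X : Finset F) (hX : HInv H X) (h0 : 0 ∉ X) :
    H.card ∣ X.card := by
  induction hc : X.card using Nat.strong_induction_on generalizing X with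
  | _ c ih =>
    rcases X.eq_empty_or_nonempty with rfl | ⟨x, hx⟩
    · simp at hc; rw [← hc]; simp
    have hx0 : x ≠ 0 := fun h => h0 (h ▸ hx)
    let C := H.image (· * x)
    have hCX : C ⊆ X := by
      intro y hy
      obtain ⟨h, hh, rfl⟩ := Finset.mem_image.mp hy
      exact hX h hh x hx
    have hCc : C.card = H.card := Finset.card_image_of_injective _ (mul_left_injective₀ hx0)
    have hcard := Finset.card_sdiff_add_card_eq_card hCX
    have hpos : 0 < H.card := Finset.card_pos.mpr ⟨1, hH.one_mem⟩
    have := ih (X \ C).card (by omega) (X \ C) ?_ ?_ rfl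
    · rw [← hc, ← hcard, hCc]
      exact dvd_add this dvd_rfl
    · intro h hh y hy
      rw [Finset.mem_sdiff] at hy ⊢
      refine ⟨hX h hh y hy.1, ?_⟩
      intro hmem
      obtain ⟨h', hh', e⟩ := Finset.mem_image.mp hmem
      apply hy.2
      refine Finset.mem_image.mpr ⟨h⁻¹ * h', hH.mul_mem _ (hH.inv_mem _ hh) _ hh', ?_⟩
      have := hH.ne_zero hh
      rw [mul_assoc, e, inv_mul_cancel_left₀ this]
    · intro h; exact h0 (Finset.mem_sdiff.mp h).1

/-- `Ssum H j` is the set of sums of exactly `j` elements of `H`. -/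
def Ssum (H : Finset F) : ℕ → Finset F
  | 0 => {0}
  | j + 1 => Ssum H j + H

lemma Ssum_one : Ssum H 1 = H := by
  change {0} + H = H
  ext x; simp [Finset.mem_add]

lemma Ssum_add (a b : ℕ) : Ssum H (a + b) = Ssum H a + Ssum H b := by
  induction b with
  | zero =>
    change Ssum H a = Ssum H a + {0}
    ext x; simp [Finset.mem_add]
  | succ b ih => rw [← add_assoc, Ssum, ih, Ssum, add_assoc]

lemma Ssum_inv (j : ℕ) : HInv H (Ssum H j) ∨ ¬ GoodH H d := by
  by_cases hH : GoodH H d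
  · left
    induction j with
    | zero => intro h _ x hx; simp [Ssum] at hx ⊢; right; exact hx
    | succ j ih =>
      intro h hh x hx
      obtain ⟨y, hy, z, hz, rfl⟩ := Finset.mem_add.mp hx
      rw [mul_add]
      exact Finset.add_mem_add (ih h hh y hy) (hH.mul_mem h hh z hz)
  · right; exact hH

lemma GoodH.Sinv (hH : GoodH H d) (j : ℕ) : HInv H (Ssum H j) :=
  (Ssum_inv (d := d) j).resolve_right (by simpa using hH)

lemma GoodH.Snonempty (hH : GoodH H d) (j : ℕ) : (Ssum H j).Nonempty := by
  induction j with
  | zero => simp [Ssum]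
  | succ j ih => exact ih.add ⟨1, hH.one_mem⟩

lemma GoodH.Hinv (hH : GoodH H d) : HInv H H := fun h hh x hx => hH.mul_mem h hh x hx

lemma univ_add_H (hH : GoodH H d) {X : Finset F} (hX : X = Finset.univ) : X + H = Finset.univ := by
  rw [Finset.eq_univ_iff_forall]
  intro x
  exact Finset.mem_add.mpr ⟨x - 1, by simp [hX], 1, hH.one_mem, by ring⟩

lemma GoodH.Suniv (hH : GoodH H d) {j i : ℕ} (hij : j ≤ i) (h : Ssum H j = Finset.univ) :
    Ssum H i = Finset.univ := by
  induction i, hij using Nat.le_induction with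
  | base => exact h
  | succ i _ ih => exact univ_add_H hH ih

lemma GoodH.S_lower (hH : GoodH H d) (j : ℕ) :
    Ssum H j = Finset.univ ∨ j * (H.card - 1) + 1 ≤ (Ssum H j).card := by
  have hpos : 0 < H.card := Finset.card_pos.mpr ⟨1, hH.one_mem⟩
  induction j with
  | zero => right; simp [Ssum]
  | succ j ih =>
    by_cases h : Ssum H (j + 1) = Finset.univ
    · left; exact h
    right
    rcases ih with ih | ih
    · exact absurd (univ_add_H hH ih) h
    · have := hH.cd hH.Hinv ⟨1, hH.one_mem⟩ (hH.Snonempty j) h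
      rw [add_mul]
      change _ ≤ (Ssum H j + H).card
      omega

/-- The case where `H` has two elements: enough summands cover everything. -/
lemma GoodH.case_two (hH : GoodH H d) (hm : H.card = 2) {j : ℕ} (hj : 2 * d ≤ j) :
    Ssum H j = Finset.univ := by
  apply hH.Suniv hj
  rcases hH.S_lower (2 * d) with h | h
  · exact h
  · have := hH.card
    rw [hm] at *
    rw [← Finset.card_eq_iff_eq_univ]
    have := Finset.card_le_univ (Ssum H (2 * d))
    omega

lemma GoodH.S_ge (hH : GoodH H d) (hm : 3 ≤ H.card) (j : ℕ) (hj : j ≤ d) :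
    j * H.card ≤ (Ssum H j).card := by
  induction j with
  | zero => simp
  | succ j ih =>
    have ih := ih (by omega)
    have hq := hH.card
    have hjm : (j + 1) * H.card ≤ d * H.card := Nat.mul_le_mul_right _ hj
    by_cases h : Ssum H (j + 1) = Finset.univ
    · rw [h, Finset.card_univ]; omega
    have h1 := hH.cd hH.Hinv ⟨1, hH.one_mem⟩ (hH.Snonempty j) h
    change _ ≤ (Ssum H (j + 1)).card + 1 at h1
    rw [add_mul, one_mul]
    by_cases h0 : (0 : F) ∈ Ssum H (j + 1)
    · have h2 := hH.dvd_card ((Ssum H (j + 1)).erase 0) (by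
        intro a ha x hx
        rw [Finset.mem_erase] at hx ⊢
        exact ⟨mul_ne_zero (hH.ne_zero ha) hx.1, hH.Sinv _ a ha x hx.2⟩) (by simp)
      rw [Finset.card_erase_of_mem h0] at h2
      obtain ⟨c, hc⟩ := h2
      have : j + 1 ≤ c := by
        by_contra hcon
        have : H.card * c ≤ H.card * j := Nat.mul_le_mul_left _ (by omega)
        rw [mul_comm H.card j] at this
        omega
      have : H.card * (j + 1) ≤ H.card * c := Nat.mul_le_mul_left _ this
      rw [mul_add, mul_comm H.card j] at this
      omega
    · obtain ⟨c, hc⟩ := hH.dvd_card _ (hH.Sinv (j + 1)) h0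
      have : j + 1 ≤ c := by
        by_contra hcon
        have : H.card * c ≤ H.card * j := Nat.mul_le_mul_left _ (by omega)
        rw [mul_comm H.card j] at this
        omega
      have : H.card * (j + 1) ≤ H.card * c := Nat.mul_le_mul_left _ this
      rw [mul_add, mul_comm H.card j] at this
      omega

/-- With at least three elements in `H`, sums of `d` elements cover all nonzero elements. -/
lemma GoodH.S_d (hH : GoodH H d) (hm : 3 ≤ H.card) {x : F} (hx : x ≠ 0) : x ∈ Ssum H d := by
  by_contra hcon
  have h1 := hH.S_ge hm d le_rfl
  have hq := hH.card
  let C := H.image (· * x)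
  have hCc : C.card = H.card := Finset.card_image_of_injective _ (mul_left_injective₀ hx)
  have hd : Disjoint C (Ssum H d) := by
    rw [Finset.disjoint_left]
    intro y hy hy'
    obtain ⟨h, hh, rfl⟩ := Finset.mem_image.mp hy
    have := hH.Sinv d h⁻¹ (hH.inv_mem _ hh) _ hy'
    rw [inv_mul_cancel_left₀ (hH.ne_zero hh)] at this
    exact hcon this
  have := Finset.card_le_univ (C ∪ Ssum H d)
  rw [Finset.card_union_of_disjoint hd] at this
  omega

lemma GoodH.S_d_succ (hH : GoodH H d) (hm : 3 ≤ H.card) {j : ℕ} (hj : d < j) :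
    Ssum H j = Finset.univ := by
  apply hH.Suniv (j := d + 1) hj
  rw [Finset.eq_univ_iff_forall]
  intro x
  obtain ⟨h, hh, hne⟩ : ∃ h ∈ H, h ≠ x := by
    by_contra hcon
    push Not at hcon
    have : H ⊆ {x} := fun y hy => Finset.mem_singleton.mpr (hcon y hy)
    have := Finset.card_le_card this
    simp at this
    omega
  exact Finset.mem_add.mpr ⟨x - h, hH.S_d hm (sub_ne_zero.mpr hne.symm), h, hh, by ring⟩

lemma Ssum_zero_mul {a : ℕ} (h : (0 : F) ∈ Ssum H a) (c : ℕ) : (0 : F) ∈ Ssum H (a * c) := by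
  induction c with
  | zero => simp [Ssum]
  | succ c ih =>
    rw [mul_add, mul_one, Ssum_add]
    exact Finset.mem_add.mpr ⟨0, ih, 0, h, by simp⟩

lemma Ssum_add_mem {a b : ℕ} {x y : F} (hx : x ∈ Ssum H a) (hy : y ∈ Ssum H b) :
    x + y ∈ Ssum H (a + b) := by
  rw [Ssum_add]; exact Finset.add_mem_add hx hy

lemma frag_inter {T X Y : Finset F} {m q : ℕ} (hq : q = Fintype.card F)
    (hcd : ∀ X : Finset F, X.Nonempty → X + T ≠ Finset.univ → X.card + m ≤ (X + T).card)
    (hX : (X + T).card = X.card + m) (hY : (Y + T).card = Y.card + m)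
    (hI : (X ∩ Y).Nonempty) (h1 : X.card + m < q) (h2 : X.card + Y.card + m < q + (X ∩ Y).card) :
    ((X ∩ Y) + T).card = (X ∩ Y).card + m := by
  have hcu : ∀ Y : Finset F, Y ≠ Finset.univ ↔ Y.card < Fintype.card F := by
    intro Y; rw [Finset.card_lt_iff_ne_univ]
  have hIX : ((X ∩ Y) + T).card ≤ (X + T).card :=
    Finset.card_le_card (Finset.add_subset_add_right Finset.inter_subset_left)
  have h3 := hcd _ hI ((hcu _).2 (by omega))
  have h4 := card_submod X Y T
  have h5 := Finset.card_union_add_card_inter X Y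
  by_cases hU : (X ∪ Y) + T = Finset.univ
  · rw [hU, Finset.card_univ] at h4
    omega
  · have h6 := hcd _ (hI.mono (Finset.inter_subset_left.trans Finset.subset_union_left)) hU
    omega

/-- The two-element fragment case. -/
lemma GoodH.no_pair (hH : GoodH H d) (hm : 3 ≤ H.card) (hneg : ∀ h ∈ H, -h ∉ H) {g : F}
    (hg : g ≠ 0)
    (hc : (insert 0 H ∪ (insert 0 H).image (· + g)).card = H.card + 2) : False := by
  set T := insert 0 H with hT
  set T' := T.image (· + g) with hT'
  have hTc : T.card = H.card + 1 := Finset.card_insert_of_notMem hH.zero_notMem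
  have hTc' : T'.card = H.card + 1 := by
    rw [hT', Finset.card_image_of_injective _ (add_left_injective g), hTc]
  have hI := Finset.card_union_add_card_inter T T'
  have h1 := Finset.card_sdiff_add_card_inter T T'
  have h2 := Finset.card_sdiff_add_card_inter T' T
  rw [Finset.inter_comm] at h2
  obtain ⟨u, hu⟩ := Finset.card_eq_one.mp (show (T \ T').card = 1 by omega)
  obtain ⟨v, hv⟩ := Finset.card_eq_one.mp (show (T' \ T).card = 1 by omega)
  have hsum : ∀ f : F → F, ∑ t ∈ T', f t - ∑ t ∈ T, f t = f v - f u := by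
    intro f
    have e1 := Finset.sum_inter_add_sum_sdiff T T' f
    have e2 := Finset.sum_inter_add_sum_sdiff T' T f
    rw [hu, Finset.sum_singleton] at e1
    rw [hv, Finset.sum_singleton, Finset.inter_comm] at e2
    rw [← e1, ← e2]; ring
  have himg : ∀ f : F → F, ∑ t ∈ T', f t = ∑ t ∈ T, f (t + g) := by
    intro f
    rw [hT', Finset.sum_image (fun a _ b _ h => add_left_injective g h)]
  have hS0 : ∑ t ∈ T, t = 0 := by
    rw [hT, Finset.sum_insert hH.zero_notMem, zero_add]
    obtain ⟨h, hh, hne⟩ : ∃ h ∈ H, h ≠ 1 := Finset.exists_mem_ne (by omega) 1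
    have e : ∑ t ∈ H, t = h * ∑ t ∈ H, t := by
      conv_lhs => rw [← hH.Hinv.image hH hh]
      rw [Finset.sum_image (fun a _ b _ e => mul_right_injective₀ (hH.ne_zero hh) e),
        Finset.mul_sum]
    have : (h - 1) * ∑ t ∈ H, t = 0 := by rw [sub_mul, one_mul, ← e, sub_self]
    exact (mul_eq_zero.mp this).resolve_left (sub_ne_zero.mpr hne)
  have e1 : v - u = (H.card + 1) * g := by
    have := hsum (fun t => t)
    rw [himg] at this
    simp only [Finset.sum_add_distrib, Finset.sum_const, hS0, hTc, nsmul_eq_mul] at this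
    push_cast at this
    rw [← this]; ring
  have e2 : v ^ 2 - u ^ 2 = (H.card + 1) * g ^ 2 := by
    have := hsum (fun t => t ^ 2)
    rw [himg] at this
    have hx : ∀ t : F, (t + g) ^ 2 = t ^ 2 + t * (2 * g) + g ^ 2 := fun t => by ring
    simp only [hx, Finset.sum_add_distrib, Finset.sum_const, ← Finset.sum_mul, hS0, hTc,
      nsmul_eq_mul] at this
    push_cast at this
    rw [← this]; ring
  have huT : u ∈ T \ T' := by rw [hu]; simp
  have hvT : v ∈ T' \ T := by rw [hv]; simp
  rw [Finset.mem_sdiff] at huT hvT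
  have huv : v - u ≠ 0 := by
    intro h
    rw [sub_eq_zero] at h
    exact hvT.2 (h ▸ huT.1)
  have e3 : v + u = g := by
    apply mul_left_cancel₀ huv
    calc (v - u) * (v + u) = v ^ 2 - u ^ 2 := by ring
      _ = (v - u) * g := by rw [e2, e1]; ring
  obtain ⟨t, ht, rfl⟩ := Finset.mem_image.mp hvT.1
  have hut : u = -t := by linear_combination e3
  rcases Finset.mem_insert.mp ht with h0 | h0
  · rw [h0] at hut
    rw [hut, h0] at e1
    have hm0 : (H.card : F) = 0 := by
      have : (H.card : F) * g = 0 := by linear_combination -e1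
      exact (mul_eq_zero.mp this).resolve_right hg
    have := hH.card
    have hq : ((d * H.card + 1 : ℕ) : F) = 0 := by rw [this]; exact Nat.cast_card_eq_zero F
    push_cast at hq
    rw [hm0] at hq
    simp at hq
  · rcases Finset.mem_insert.mp huT.1 with h | h
    · rw [h] at hut
      exact hH.ne_zero h0 (by linear_combination hut)
    · exact hneg t h0 (hut ▸ h)

lemma GoodH.final (hH : GoodH H d) (hm : 3 ≤ H.card) (hd4 : 4 ≤ d) (hd2 : 2 ∣ d) :
    (0 : F) ∈ Ssum H d ∨ (0 : F) ∈ Ssum H (d - 1) := by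
  by_contra hcon
  push Not at hcon
  obtain ⟨hn1, hn2⟩ := hcon
  set m := H.card with hmdef
  have hq := hH.card
  rw [← hmdef] at hq
  have hS2 : (0 : F) ∉ Ssum H 2 := by
    intro h
    obtain ⟨c, rfl⟩ := hd2
    exact hn1 (Ssum_zero_mul h c)
  have hneg : ∀ h ∈ H, -h ∉ H := by
    intro h hh hh'
    rw [← Ssum_one (H := H)] at hh hh'
    exact hS2 (by simpa using Ssum_add_mem hh hh')
  -- H is contained in S_2
  have hHS : H ⊆ Ssum H 2 := by
    have hdis : Disjoint (H ∪ Ssum H 2) ((Ssum H (d - 2)).image (fun x => -x)) := by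
      rw [Finset.disjoint_left]
      intro x hx hx'
      obtain ⟨y, hy, rfl⟩ := Finset.mem_image.mp hx'
      rcases Finset.mem_union.mp hx with h | h
      · rw [← Ssum_one (H := H)] at h
        have := Ssum_add_mem h hy
        rw [neg_add_cancel, show 1 + (d - 2) = d - 1 by omega] at this
        exact hn2 this
      · have := Ssum_add_mem h hy
        rw [neg_add_cancel, show 2 + (d - 2) = d by omega] at this
        exact hn1 this
    have h1 := Finset.card_le_univ ((H ∪ Ssum H 2) ∪ ((Ssum H (d - 2)).image (fun x => -x)))
    rw [Finset.card_union_of_disjoint hdis, Finset.card_image_of_injective _ neg_injective,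
      ← hq] at h1
    have h2 := hH.S_ge hm (d - 2) (by omega)
    have h3 := hH.S_ge hm 2 (by omega)
    rw [← hmdef] at h2 h3
    obtain ⟨c, hc⟩ := hH.dvd_card (H ∪ Ssum H 2) (by
      intro a ha x hx
      rcases Finset.mem_union.mp hx with h | h
      · exact Finset.mem_union_left _ (hH.Hinv a ha x h)
      · exact Finset.mem_union_right _ (hH.Sinv 2 a ha x h)) (by
      simp [hH.zero_notMem, hS2])
    rw [← hmdef] at hc
    have hdd : d * m = (d - 2) * m + 2 * m := by rw [← add_mul]; congr 1; omega
    have hc2 : c ≤ 2 := by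
      by_contra hcon
      have : m * 3 ≤ m * c := Nat.mul_le_mul_left _ (by omega)
      omega
    have : m * c ≤ m * 2 := Nat.mul_le_mul_left _ hc2
    have he := Finset.eq_of_subset_of_card_le
      (Finset.subset_union_right (s₁ := H) (s₂ := Ssum H 2)) (by omega)
    rw [he]; exact Finset.subset_union_left
  have hSsucc : ∀ j, 1 ≤ j → Ssum H j ⊆ Ssum H (j + 1) := by
    intro j hj
    obtain ⟨i, rfl⟩ : ∃ i, j = i + 1 := ⟨j - 1, by omega⟩
    rw [add_assoc, Ssum_add, Ssum_add i (1 + 1), Ssum_one]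
    exact Finset.add_subset_add_left hHS
  have hSmono : ∀ j i, 1 ≤ j → j ≤ i → Ssum H j ⊆ Ssum H i := by
    intro j i hj hi
    induction i, hi using Nat.le_induction with
    | base => exact Finset.Subset.refl _
    | succ i hi ih => exact ih.trans (hSsucc i (by omega))
  have hS0 : ∀ j, 1 ≤ j → j ≤ d → (0 : F) ∉ Ssum H j :=
    fun j h1 h2 h => hn1 (hSmono j d h1 h2 h)
  have hstep : ∀ j, 1 ≤ j → j + 1 ≤ d → (Ssum H j).card + m ≤ (Ssum H (j + 1)).card := by
    intro j h1 h2
    have h0 := hS0 (j + 1) (by omega) h2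
    have h3 := hH.cd hH.Hinv ⟨1, hH.one_mem⟩ (hH.Snonempty j) (X := Ssum H j) (by
      intro h
      exact h0 (by change (0 : F) ∈ Ssum H j + H; rw [h]; exact Finset.mem_univ _))
    change _ ≤ (Ssum H (j + 1)).card + 1 at h3
    obtain ⟨a, ha⟩ := hH.dvd_card _ (hH.Sinv j) (hS0 j h1 (by omega))
    obtain ⟨b, hb⟩ := hH.dvd_card _ (hH.Sinv (j + 1)) h0
    rw [← hmdef] at ha hb h3
    rw [ha, hb] at h3 ⊢
    have : a + 1 ≤ b := by
      by_contra hcon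
      have : m * b ≤ m * a := Nat.mul_le_mul_left _ (by omega)
      omega
    have : m * (a + 1) ≤ m * b := Nat.mul_le_mul_left _ this
    linarith
  have hScard : ∀ j, 1 ≤ j → j ≤ d → (Ssum H j).card = j * m := by
    intro j h1 h2
    have hup : ∀ i, j + i ≤ d → (Ssum H j).card + i * m ≤ (Ssum H (j + i)).card := by
      intro i
      induction i with
      | zero => intro _; simp
      | succ i ih =>
        intro h
        have e1 := ih (by omega)
        have e2 := hstep (j + i) (by omega) (by omega)
        rw [← add_assoc, add_mul]
        omega
    have e1 := hup (d - j) (by omega)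
    rw [show j + (d - j) = d by omega] at e1
    have e2 : (Ssum H d).card < Fintype.card F := by
      rw [Finset.card_lt_iff_ne_univ]
      intro h
      exact hn1 (by rw [h]; exact Finset.mem_univ _)
    have e3 := hH.S_ge hm j h2
    rw [← hmdef] at e3
    have e4 : d * m = j * m + (d - j) * m := by rw [← add_mul]; congr 1; omega
    omega
  -- T and fragments
  set T := insert 0 H with hT
  have hTc : T.card = m + 1 := Finset.card_insert_of_notMem hH.zero_notMem
  have hTinv : HInv H T := by
    intro a ha x hx
    rcases Finset.mem_insert.mp hx with h | h
    · rw [h, mul_zero]; exact Finset.mem_insert_self _ _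
    · exact Finset.mem_insert_of_mem (hH.Hinv a ha x h)
  have hcd : ∀ X : Finset F, X.Nonempty → X + T ≠ Finset.univ → X.card + m ≤ (X + T).card := by
    intro X hX hXT
    have := hH.cd hTinv ⟨0, Finset.mem_insert_self _ _⟩ hX hXT
    omega
  have hST : ∀ j, 1 ≤ j → Ssum H j + T = Ssum H (j + 1) := by
    intro j hj
    ext x
    constructor
    · intro hx
      obtain ⟨y, hy, t, ht, rfl⟩ := Finset.mem_add.mp hx
      rcases Finset.mem_insert.mp ht with h | h
      · rw [h, add_zero]; exact hSsucc j hj hy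
      · exact Finset.add_mem_add hy h
    · intro hx
      obtain ⟨y, hy, t, ht, rfl⟩ := Finset.mem_add.mp hx
      exact Finset.add_mem_add hy (Finset.mem_insert_of_mem ht)
  have hST' : ∀ j, 1 ≤ j → insert 0 (Ssum H j) + T = insert 0 (Ssum H (j + 1)) := by
    intro j hj
    rw [← hST j hj]
    ext x
    constructor
    · intro hx
      obtain ⟨y, hy, t, ht, rfl⟩ := Finset.mem_add.mp hx
      rcases Finset.mem_insert.mp hy with h | h
      · rw [h, zero_add]
        rcases Finset.mem_insert.mp ht with h' | h'
        · rw [h']; exact Finset.mem_insert_self _ _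
        · refine Finset.mem_insert_of_mem ?_
          rw [hST j hj]
          exact hSmono 1 (j + 1) le_rfl (by omega) (by rw [Ssum_one]; exact h')
      · exact Finset.mem_insert_of_mem (Finset.add_mem_add h ht)
    · intro hx
      rcases Finset.mem_insert.mp hx with h | h
      · rw [h]
        exact Finset.mem_add.mpr ⟨0, Finset.mem_insert_self _ _, 0, Finset.mem_insert_self _ _,
          by simp⟩
      · exact Finset.add_subset_add_right (Finset.subset_insert _ _) h
  have hF1 : ∀ j, 1 ≤ j → j + 2 ≤ d → (Ssum H j + T).card = (Ssum H j).card + m := by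
    intro j h1 h2
    rw [hST j h1, hScard j h1 (by omega), hScard (j + 1) (by omega) (by omega)]
    ring
  have hIc : ∀ j, 1 ≤ j → j ≤ d → (insert 0 (Ssum H j)).card = j * m + 1 := by
    intro j h1 h2
    rw [Finset.card_insert_of_notMem (hS0 j h1 h2), hScard j h1 h2]
  have hF2 : ∀ j, 1 ≤ j → j + 2 ≤ d →
      (insert 0 (Ssum H j) + T).card = (insert 0 (Ssum H j)).card + m := by
    intro j h1 h2
    rw [hST' j h1, hIc j h1 (by omega), hIc (j + 1) (by omega) (by omega)]
    ring
  obtain ⟨R, hR, hRmin⟩ := Finset.exists_min_image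
    (Finset.univ.filter fun X : Finset F =>
      2 ≤ X.card ∧ X.card ≤ m ∧ (X + T).card = X.card + m) Finset.card ⟨H, by
      rw [Finset.mem_filter]
      refine ⟨Finset.mem_univ _, by omega, le_rfl, ?_⟩
      have := hF1 1 le_rfl (by omega)
      rwa [Ssum_one] at this⟩
  rw [Finset.mem_filter] at hR
  obtain ⟨-, hR2, hRm, hRF⟩ := hR
  have hdm : 4 * m ≤ d * m := Nat.mul_le_mul_right _ hd4
  have hkey : ∀ j, 1 ≤ j → j + 2 ≤ d → 3 ≤ R.card → ∀ x ∈ R, ∀ y ∈ R, x - y ∈ Ssum H j → False := by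
    intro j h1 h2 h3 x hx y hy hxy
    have hjm : (j + 2) * m ≤ d * m := Nat.mul_le_mul_right _ h2
    rw [add_mul] at hjm
    have hj0 := hS0 j h1 (by omega)
    have hxy0 : x ≠ y := by
      rintro rfl
      rw [sub_self] at hxy
      exact hj0 hxy
    have hinj := add_left_injective (G := F) y
    -- first intersection
    set Y := (insert 0 (Ssum H j)).image (· + y) with hY
    have hYc : Y.card = j * m + 1 := by
      rw [hY, Finset.card_image_of_injective _ hinj, hIc j h1 (by omega)]
    have hYF : (Y + T).card = Y.card + m := by
      rw [hY, card_translate, hF2 j h1 h2, Finset.card_image_of_injective _ hinj]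
    have hxI : x ∈ R ∩ Y := Finset.mem_inter.mpr ⟨hx, Finset.mem_image.mpr
      ⟨x - y, Finset.mem_insert_of_mem hxy, by ring⟩⟩
    have hyI : y ∈ R ∩ Y := Finset.mem_inter.mpr ⟨hy, Finset.mem_image.mpr
      ⟨0, Finset.mem_insert_self _ _, by ring⟩⟩
    have hI2 : 2 ≤ (R ∩ Y).card := Finset.one_lt_card.mpr ⟨x, hxI, y, hyI, hxy0⟩
    have hIR : (R ∩ Y).card ≤ R.card := Finset.card_le_card Finset.inter_subset_left
    have hIF := frag_inter hq hcd hRF hYF ⟨x, hxI⟩ (by omega) (by omega)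
    have hmin := hRmin (R ∩ Y) (by
      rw [Finset.mem_filter]
      exact ⟨Finset.mem_univ _, hI2, by omega, hIF⟩)
    have hRY : R ⊆ Y := Finset.inter_eq_left.mp
      (Finset.eq_of_subset_of_card_le Finset.inter_subset_left hmin)
    -- second intersection
    set Z := (Ssum H j).image (· + y) with hZ
    have hZc : Z.card = j * m := by
      rw [hZ, Finset.card_image_of_injective _ hinj, hScard j h1 (by omega)]
    have hZF : (Z + T).card = Z.card + m := by
      rw [hZ, card_translate, hF1 j h1 h2, Finset.card_image_of_injective _ hinj]
    have hRZ : R ∩ Z = R.erase y := by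
      ext z
      rw [Finset.mem_inter, Finset.mem_erase]
      constructor
      · rintro ⟨hz, hz'⟩
        refine ⟨?_, hz⟩
        rintro rfl
        obtain ⟨s, hs, e⟩ := Finset.mem_image.mp hz'
        have : s = 0 := by linear_combination e
        exact hj0 (this ▸ hs)
      · rintro ⟨hz, hz'⟩
        refine ⟨hz', ?_⟩
        obtain ⟨s, hs, e⟩ := Finset.mem_image.mp (hRY hz')
        rcases Finset.mem_insert.mp hs with h | h
        · exact absurd (by rw [← e, h, zero_add]) hz
        · exact Finset.mem_image.mpr ⟨s, h, e⟩
    have hEc : (R ∩ Z).card = R.card - 1 := by rw [hRZ, Finset.card_erase_of_mem hy]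
    have hEF := frag_inter hq hcd hRF hZF (Finset.card_pos.mp (by omega)) (by omega) (by omega)
    have := hRmin (R ∩ Z) (by
      rw [Finset.mem_filter]
      exact ⟨Finset.mem_univ _, by omega, by omega, hEF⟩)
    omega
  have hR3 : R.card = 2 := by
    by_contra hne
    obtain ⟨w, hw, w', hw', hww⟩ := Finset.one_lt_card.mp (show 1 < R.card by omega)
    have hdis : Disjoint (Ssum H (d - 2)) ((insert 0 (Ssum H 2)).image (fun x => -x)) := by
      rw [Finset.disjoint_left]
      intro x hx hx'
      obtain ⟨y, hy, rfl⟩ := Finset.mem_image.mp hx'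
      rcases Finset.mem_insert.mp hy with h | h
      · rw [h, neg_zero] at hx
        exact hS0 (d - 2) (by omega) (by omega) hx
      · have := Ssum_add_mem hx h
        rw [neg_add_cancel, show (d - 2) + 2 = d by omega] at this
        exact hn1 this
    have hun : Ssum H (d - 2) ∪ (insert 0 (Ssum H 2)).image (fun x => -x) = Finset.univ := by
      rw [← Finset.card_eq_iff_eq_univ, Finset.card_union_of_disjoint hdis,
        Finset.card_image_of_injective _ neg_injective, hIc 2 (by omega) (by omega),
        hScard (d - 2) (by omega) (by omega), ← hq, ← add_assoc, ← add_mul,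
        show d - 2 + 2 = d by omega]
    have hmem := Finset.mem_univ (w - w')
    rw [← hun] at hmem
    rcases Finset.mem_union.mp hmem with h | h
    · exact hkey (d - 2) (by omega) (by omega) (by omega) w hw w' hw' h
    · obtain ⟨s, hs, e⟩ := Finset.mem_image.mp h
      have e' : s = w' - w := by linear_combination -e
      rcases Finset.mem_insert.mp hs with h0 | h0
      · rw [h0] at e'
        exact hww (by linear_combination e')
      · exact hkey 2 (by omega) (by omega) (by omega) w' hw' w hw (e' ▸ h0)
  obtain ⟨a, b, hab, hRab⟩ := Finset.card_eq_two.mp hR3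
  refine hH.no_pair hm hneg (g := b - a) (sub_ne_zero.mpr hab.symm) ?_
  have e : R + T = (T ∪ T.image (· + (b - a))).image (· + a) := by
    ext x
    rw [hRab]
    simp only [Finset.mem_add, Finset.mem_image, Finset.mem_union, Finset.mem_insert,
      Finset.mem_singleton]
    constructor
    · rintro ⟨r, rfl | rfl, t, ht, rfl⟩
      · exact ⟨t, Or.inl ht, by ring⟩
      · exact ⟨t + (r - a), Or.inr ⟨t, ht, rfl⟩, by ring⟩
    · rintro ⟨s, hs | ⟨t, ht, rfl⟩, rfl⟩
      · exact ⟨a, Or.inl rfl, s, hs, by ring⟩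
      · exact ⟨b, Or.inr rfl, t, ht, by ring⟩
  rw [e, Finset.card_image_of_injective _ (add_left_injective a), hR3] at hRF
  rw [← hT]
  omega

lemma Ssum_fin {j : ℕ} {x : F} (hx : x ∈ Ssum H j) :
    ∃ f : Fin j → F, (∀ i, f i ∈ H) ∧ x = ∑ i, f i := by
  induction j generalizing x with
  | zero =>
    refine ⟨fun _ => 0, fun i => i.elim0, ?_⟩
    simpa [Ssum] using hx
  | succ j ih =>
    obtain ⟨y, hy, z, hz, rfl⟩ := Finset.mem_add.mp hx
    obtain ⟨f, hf, rfl⟩ := ih hy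
    refine ⟨Fin.cons z f, ?_, ?_⟩
    · intro i
      refine Fin.cases ?_ ?_ i
      · simpa using hz
      · intro i; simpa using hf i
    · rw [Fin.sum_univ_succ]; simp [add_comm]

lemma Ssum_fin' {j : ℕ} {x : F} (hx : x ∈ Ssum H j) :
    ∃ f : Fin (j + 1) → F, (∀ i, f i = 0 ∨ f i ∈ H) ∧ (∀ i, f i ∉ H → i = 0) ∧ x = ∑ i, f i := by
  obtain ⟨f, hf, rfl⟩ := Ssum_fin hx
  refine ⟨Fin.cons 0 f, ?_, ?_, ?_⟩
  · intro i
    refine Fin.cases ?_ ?_ i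
    · simp
    · intro i; right; simpa using hf i
  · intro i
    refine Fin.cases ?_ ?_ i
    · simp
    · intro i h; exact absurd (by simpa using hf i) h
  · rw [Fin.sum_univ_succ]; simp
end

section
variable {F : Type*} [Field F] [Fintype F] [DecidableEq F]

/-- The nonzero `k`-th powers. -/
def powSet (F : Type*) [Field F] [Fintype F] [DecidableEq F] (k : ℕ) : Finset F :=
  (Finset.univ : Finset Fˣ).image fun u => ((u ^ k : Fˣ) : F)

lemma mem_powSet {k : ℕ} {x : F} : x ∈ powSet F k ↔ ∃ u : Fˣ, ((u ^ k : Fˣ) : F) = x := by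
  simp [powSet]

lemma gcd_pow_mem (k : ℕ) {x : F} (hx : x ≠ 0) :
    x ^ (Nat.gcd k (Fintype.card F - 1)) ∈ powSet F k := by
  rw [mem_powSet]
  set Q := Fintype.card F with hQ
  lift x to Fˣ using isUnit_iff_ne_zero.mpr hx
  have hcard : x ^ (Q - 1) = 1 := by
    rw [hQ, ← Fintype.card_units]; exact pow_card_eq_one
  refine ⟨x ^ (Nat.gcdA k (Q - 1)), ?_⟩
  rw [← Units.val_pow_eq_pow_val]
  congr 1
  rw [← zpow_natCast, ← zpow_natCast, ← zpow_mul, Nat.gcd_eq_gcd_ab, zpow_add,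
    zpow_mul x ((Q - 1 : ℕ) : ℤ), zpow_natCast, hcard, one_zpow, mul_one, mul_comm]

lemma powSet_good (k d : ℕ) (hd : d = Nat.gcd k (Fintype.card F - 1)) (hd0 : d ≠ 0)
    (hW : ∀ x : F, ∃ f : Fin d → F, x = ∑ i, (f i) ^ d) : GoodH (powSet F k) d where
  one_mem := mem_powSet.mpr ⟨1, by simp⟩
  zero_notMem := by
    rw [mem_powSet]
    rintro ⟨u, hu⟩
    exact (u ^ k).ne_zero hu
  mul_mem := by
    intro a ha b hb
    rw [mem_powSet] at *
    obtain ⟨u, rfl⟩ := ha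
    obtain ⟨v, rfl⟩ := hb
    exact ⟨u * v, by rw [mul_pow, Units.val_mul]⟩
  inv_mem := by
    intro a ha
    rw [mem_powSet] at *
    obtain ⟨u, rfl⟩ := ha
    exact ⟨u⁻¹, by rw [inv_pow, Units.val_inv_eq_inv_val]⟩
  span := by
    intro x
    obtain ⟨f, hf⟩ := hW x
    refine ⟨fun i => f i ^ d, ?_, hf⟩
    intro i
    by_cases h : f i = 0
    · left; simp only [h]; exact zero_pow hd0
    · right
      have := gcd_pow_mem k h
      rwa [← hd] at this
  card := by
    have h1 : (powSet F k).card = Nat.card (powMonoidHom k : Fˣ →* Fˣ).range := by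
      have : (powSet F k : Set F) = Units.val '' ((powMonoidHom k : Fˣ →* Fˣ).range : Set Fˣ) := by
        ext x
        simp only [Finset.mem_coe, mem_powSet, Set.mem_image, SetLike.mem_coe,
          MonoidHom.mem_range, powMonoidHom_apply]
        constructor
        · rintro ⟨u, rfl⟩; exact ⟨_, ⟨u, rfl⟩, rfl⟩
        · rintro ⟨_, ⟨u, rfl⟩, rfl⟩; exact ⟨u, rfl⟩
      rw [← Set.ncard_coe_finset, this, Set.ncard_image_of_injective _ Units.val_injective]
      rfl
    rw [h1, IsCyclic.card_powMonoidHom_range, Nat.card_eq_fintype_card, Fintype.card_units,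
      Nat.gcd_comm, ← hd, Nat.mul_div_cancel']
    · have : 1 < Fintype.card F := Fintype.one_lt_card
      omega
    · rw [hd]; exact Nat.gcd_dvd_right _ _

lemma nonscalar_sum {n k d : ℕ} (hn : 2 ≤ n) (hkF : (k : F) ≠ 0)
    (hG : GoodH (powSet F k) d) (M : Matrix (Fin n) (Fin n) F) (hM : ∀ c : F, M ≠ c • 1)
    (h : M.trace ∈ Ssum (powSet F k) (n + n) ∨ M.trace ∈ Ssum (powSet F k) (n + (n - 1))) :
    ∃ A B : Matrix (Fin n) (Fin n) F, M = A ^ k + B ^ k := by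
  have hk0 : k ≠ 0 := by rintro rfl; simp at hkF
  have hroot : ∀ x : F, x = 0 ∨ x ∈ powSet F k → ∃ b, b ^ k = x := by
    rintro x (rfl | hx)
    · exact ⟨0, zero_pow hk0⟩
    · obtain ⟨u, rfl⟩ := mem_powSet.mp hx
      exact ⟨u, by simp⟩
  rcases h with h | h
  · rw [Ssum_add] at h
    obtain ⟨y, hy, z, hz, e⟩ := Finset.mem_add.mp h
    obtain ⟨f, hf, rfl⟩ := Ssum_fin hy
    obtain ⟨g, hg, rfl⟩ := Ssum_fin hz
    exact nonscalar_case (by omega) hkF M hM f g (fun i => hroot _ (Or.inr (hf i)))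
      (fun i => hroot _ (Or.inr (hg i))) (fun i _ h => absurd h (hG.ne_zero (hf i)))
      (fun i _ h => absurd h (hG.ne_zero (hg i))) e.symm
  · rw [Ssum_add] at h
    obtain ⟨y, hy, z, hz, e⟩ := Finset.mem_add.mp h
    obtain ⟨f, hf, rfl⟩ := Ssum_fin hy
    obtain ⟨j, rfl⟩ : ∃ j, n = j + 1 := ⟨n - 1, by omega⟩
    rw [Nat.add_sub_cancel] at hz
    obtain ⟨g, hg, hg0, rfl⟩ := Ssum_fin' hz
    have hz0 : ∀ i, g i = 0 → i = 0 := fun i h => hg0 i (by rw [h]; exact hG.zero_notMem)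
    exact nonscalar_case (by omega) hkF M hM f g (fun i => hroot _ (Or.inr (hf i)))
      (fun i => hroot _ (hg i)) (fun i _ h => absurd h (hG.ne_zero (hf i)))
      (fun i j h h' => (hz0 i h).trans (hz0 j h').symm) e.symm

lemma scalar_two {n k d : ℕ} (hk0 : k ≠ 0) (hd : d = Nat.gcd k (Fintype.card F - 1)) (hd2 : d = 2)
    (hW : ∀ x : F, ∃ f : Fin d → F, x = ∑ i, (f i) ^ d) (c : F) :
    ∃ A B : Matrix (Fin n) (Fin n) F, c • (1 : Matrix (Fin n) (Fin n) F) = A ^ k + B ^ k := by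
  have hroot : ∀ x : F, ∃ b : F, b ^ k = x ^ d := by
    intro x
    by_cases hx : x = 0
    · exact ⟨0, by rw [hx, zero_pow hk0, zero_pow (by omega)]⟩
    · have := gcd_pow_mem k hx
      rw [← hd] at this
      obtain ⟨u, hu⟩ := mem_powSet.mp this
      exact ⟨u, by rw [← hu]; simp⟩
  obtain ⟨f, hf⟩ := hW c
  choose b hb using hroot
  have hc : ∃ x y : F, c = x ^ k + y ^ k := by
    clear hW
    subst hd2
    rw [Fin.sum_univ_two] at hf
    exact ⟨b (f 0), b (f 1), by rw [hb, hb, hf]⟩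
  obtain ⟨x, y, rfl⟩ := hc
  exact ⟨x • 1, y • 1, by rw [smul_pow, smul_pow, one_pow, add_smul]⟩

lemma scalar_ext (p : ℕ) (hp : p.Prime) [CharP F p] {n k : ℕ} (hk : 1 ≤ k) (hn : 2 ≤ n)
    (hq : Fintype.card F ^ n > (k - 1) ^ 4) (c : F) :
    ∃ A B : Matrix (Fin n) (Fin n) F, c • (1 : Matrix (Fin n) (Fin n) F) = A ^ k + B ^ k := by
  haveI : Fact p.Prime := ⟨hp⟩
  haveI : NeZero n := ⟨by omega⟩
  let E := FiniteField.Extension F p n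
  letI : Fintype E := Fintype.ofFinite E
  have hE : Fintype.card E > (k - 1) ^ 4 := by
    rw [← Nat.card_eq_fintype_card, FiniteField.natCard_extension, Nat.card_eq_fintype_card]
    exact hq
  obtain ⟨x, y, hxy⟩ := weil_sum k hk hE (algebraMap F E c)
  let b : Module.Basis (Fin n) F E := Module.finBasisOfFinrankEq F E (FiniteField.finrank_extension F p n)
  refine ⟨Algebra.leftMulMatrix b x, Algebra.leftMulMatrix b y, ?_⟩
  rw [← map_pow, ← map_pow, ← map_add, ← hxy, AlgHom.commutes, Algebra.algebraMap_eq_smul_one]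
end

theorem stmt17 (p : ℕ) (hp : p.Prime) (F : Type*) [Field F] [Fintype F] [CharP F p]
    (k n : ℕ) (hk : 1 ≤ k) (hn : 2 ≤ n) (hpk : ¬ p ∣ k)
    (d : ℕ) (hd : d = Nat.gcd k (Fintype.card F - 1))
    (hW : ∀ x : F, ∃ f : Fin d → F, x = ∑ i, (f i) ^ d) :
    (Fintype.card F ≥ 3 * d + 1 →
      (d = 2 ∨ (d > 2 ∧ 2 * n > d - 1 ∧ Fintype.card F ^ n > (k - 1) ^ 4)) →
      ∀ M : Matrix (Fin n) (Fin n) F, ∃ A B : Matrix (Fin n) (Fin n) F,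
        M = A ^ k + B ^ k) ∧
    (Fintype.card F = 2 * d + 1 →
      (d = 2 ∨ (d > 2 ∧ n > 2 * d - 1 ∧ Fintype.card F ^ n > (k - 1) ^ 4)) →
      ∀ M : Matrix (Fin n) (Fin n) F, ∃ A B : Matrix (Fin n) (Fin n) F,
        M = A ^ k + B ^ k) := by
  classical
  have hkF : (k : F) ≠ 0 := by
    rw [Ne, CharP.cast_eq_zero_iff F p]; exact hpk
  have hd0 : d ≠ 0 := by
    rw [hd]; exact (Nat.gcd_pos_of_pos_left _ hk).ne'
  have hG := powSet_good k d hd hd0 hW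
  have hq := hG.card
  constructor
  · intro h3 hor M
    have hm : 3 ≤ (powSet F k).card := by
      by_contra hcon
      have : d * (powSet F k).card ≤ d * 2 := Nat.mul_le_mul_left _ (by omega)
      omega
    by_cases hM : ∃ c : F, M = c • 1
    · obtain ⟨c, rfl⟩ := hM
      rcases hor with h | ⟨_, _, h⟩
      · exact scalar_two (by omega) hd h hW c
      · exact scalar_ext p hp hk hn h c
    · push Not at hM
      apply nonscalar_sum hn hkF hG M hM
      by_cases hdn : d < n + n
      · left; rw [hG.S_d_succ hm hdn]; exact Finset.mem_univ _
      · have hdn' : n + n = d := by omega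
        by_cases ht : M.trace = 0
        · rw [ht, ← Nat.add_sub_assoc (by omega), hdn']
          exact hG.final hm (by omega) (by omega)
        · left; rw [hdn']; exact hG.S_d hm ht
  · intro h2 hor M
    have hm : (powSet F k).card = 2 := by
      apply Nat.eq_of_mul_eq_mul_left (Nat.pos_of_ne_zero hd0)
      omega
    by_cases hM : ∃ c : F, M = c • 1
    · obtain ⟨c, rfl⟩ := hM
      rcases hor with h | ⟨_, _, h⟩
      · exact scalar_two (by omega) hd h hW c
      · exact scalar_ext p hp hk hn h c
    · push Not at hM
      apply nonscalar_sum hn hkF hG M hM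
      left
      rw [hG.case_two hm (by omega)]
      exact Finset.mem_univ _
end
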